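/- Let t, r be the square-edge distributions. For m ∈ {1,2,3}, draw labeled samples {(u_i, v_i, b_i)}_{i=1}^m from the pair ((t+r)/2, (t+r)/2) (each label b_i uniform in {0,1} and the point drawn from the corresponding component), and draw labeled samples {(x_i, y_i, ℓ_i)}_{i=1}^m from a random pair that equals (t, r) with probability 1/2 and (r, t) with probability 1/2. Let f₁, f₂, f₃, f₄ be four independent random maps drawn from M(W). Then, for all sufficiently large W, the total variation distance between the law of the tuple {(f₁(u_i), f₂(v_i), b_i)}_{i=1}^m and the law of the tuple {(f₃(x_i), f₄(y_i), ℓ_i)}_{i=1}^m is 0 for m = 1, and at most C·(log log log W)/(log log W) for m = 2, 3, where C is a universal constant. -/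

import Mathlib

open MeasureTheory
open scoped ENNReal

/-- The square-edge distribution `t` (uniform on the upper-left and lower-right edges of
the square with vertices `(1/2,0)`, `(1,1/2)`, `(1/2,1)`, `(0,1/2)`). -/
noncomputable def tDist : Measure (ℝ × ℝ) :=
  (volume.restrict (Set.Icc (0 : ℝ) 1)).map fun s =>
    if s ≤ 1 / 2 then (s, 1 / 2 + s) else (s, s - 1 / 2)

/-- The square-edge distribution `r` (uniform on the lower-left and upper-right edges). -/
noncomputable def rDist : Measure (ℝ × ℝ) :=
  (volume.restrict (Set.Icc (0 : ℝ) 1)).map fun s =>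
    if s ≤ 1 / 2 then (s, 1 / 2 - s) else (s, 3 / 2 - s)

/-- Labeled sampling from a pair of distributions `(p, q)` on `ℝ²`: independently for
each `i`, draw a uniform label and then a point from `p` or `q` accordingly. -/
noncomputable def labeledSamples (m : ℕ) (p q : Measure (ℝ × ℝ)) :
    Measure ((Fin m → ℝ × ℝ) × (Fin m → Bool)) :=
  ((PMF.uniformOfFintype (Fin m → Bool)).toMeasure).bind fun ℓ =>
    (Measure.pi fun i => if ℓ i then q else p).map fun xs => (xs, ℓ)

/-- The uniform probability measure on the interval `[a, b]`. -/
noncomputable def unifIcc (a b : ℝ) : Measure ℝ :=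
  (ENNReal.ofReal (b - a))⁻¹ • volume.restrict (Set.Icc a b)

/-- The joint law of the parameters `(λ₁, λ₂, λ₃)` of a random map from `M(W)`. -/
noncomputable def mwParams (W : ℝ) : Measure (ℝ × ℝ × ℝ) :=
  (unifIcc (Real.log (Real.log W)) (2 * Real.log (Real.log W))).prod
    ((unifIcc 0 ((Real.log W) ^ 3)).prod
      (unifIcc 0 (Real.exp (2 * (Real.log W) ^ 3))))

/-- The monotone map `f(x) = exp(x·exp λ₁)·exp λ₂ + λ₃` determined by the parameters. -/
noncomputable def applyMW (l : ℝ × ℝ × ℝ) (x : ℝ) : ℝ :=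
  Real.exp (x * Real.exp l.1) * Real.exp l.2.1 + l.2.2

/-- The law of the labeled samples after applying two independent random maps from
`M(W)` to the `x`- and `y`-coordinates respectively. -/
noncomputable def transformedLaw (W : ℝ) (m : ℕ)
    (μ : Measure ((Fin m → ℝ × ℝ) × (Fin m → Bool))) :
    Measure ((Fin m → ℝ × ℝ) × (Fin m → Bool)) :=
  (((mwParams W).prod (mwParams W)).prod μ).map fun ω =>
    ((fun i => (applyMW ω.1.1 (ω.2.1 i).1, applyMW ω.1.2 (ω.2.1 i).2)), ω.2.2)

/-- Total variation distance `sup_A |μ(A) − ν(A)|` over measurable sets. -/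
noncomputable def tvDist {X : Type*} [MeasurableSpace X] (μ ν : Measure X) : ℝ :=
  ⨆ A : {A : Set X // MeasurableSet A}, |(μ A.1).toReal - (ν A.1).toReal|

open Set

lemma volume_restrict_image_le_map {φ : ℝ → ℝ} {α β : ℝ} (hαβ : α ≤ β) (hφ : Measurable φ)
    (hmono : MonotoneOn φ (Icc α β)) (hanti : AntitoneOn (fun x => φ x - x) (Icc α β)) :
    volume.restrict (Icc (φ α) (φ β)) ≤ (volume.restrict (Icc α β)).map φ := by
  have hlip : LipschitzOnWith 1 φ (Icc α β) := by
    refine LipschitzOnWith.of_le_add fun x hx y hy => ?_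
    rcases le_total x y with h | h
    · exact (hmono hx hy h).trans (le_add_of_nonneg_right dist_nonneg)
    · have := hanti hy hx h
      have h' : x - y ≤ dist x y := by rw [Real.dist_eq]; exact le_abs_self _
      simp only at this
      linarith
  refine Measure.le_iff.2 fun B hB => ?_
  rw [Measure.restrict_apply hB, Measure.map_apply hφ hB,
    Measure.restrict_apply (hφ hB)]
  have hsub : B ∩ Icc (φ α) (φ β) ⊆ φ '' (φ ⁻¹' B ∩ Icc α β) := by
    rintro y ⟨hyB, hy⟩
    obtain ⟨x, hx, rfl⟩ := intermediate_value_Icc hαβ hlip.continuousOn hy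
    exact ⟨x, ⟨hyB, hx⟩, rfl⟩
  refine (measure_mono hsub).trans ?_
  have := (hlip.mono (inter_subset_right : φ ⁻¹' B ∩ Icc α β ⊆ _)).hausdorffMeasure_image_le
    (d := 1) zero_le_one
  simpa [hausdorffMeasure_real] using this

lemma lintegral_unifIcc_le {φ : ℝ → ℝ} {α β δ : ℝ} (hαβ : α < β) (hφ : Measurable φ)
    (hmono : MonotoneOn φ (Icc α β)) (hanti : AntitoneOn (fun x => φ x - x) (Icc α β))
    {g : ℝ → ℝ≥0∞} (hg : Measurable g) (hg1 : ∀ x, g x ≤ 1)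
    (hα : |φ α - α| ≤ δ * (β - α)) (hβ : |φ β - β| ≤ δ * (β - α)) :
    ∫⁻ x, g x ∂unifIcc α β ≤ ∫⁻ x, g (φ x) ∂unifIcc α β + ENNReal.ofReal (2 * δ) := by
  have hpos : 0 < β - α := sub_pos.2 hαβ
  have h1 : ∫⁻ x in Icc α β, g x ≤
      (∫⁻ x in Icc α β, g (φ x)) + ENNReal.ofReal (2 * δ * (β - α)) := by
    have hsub : Icc α β ⊆ Icc (φ α) (φ β) ∪ (Icc α (φ α) ∪ Icc (φ β) β) := by
      intro x hx
      by_cases h : φ α ≤ x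
      · by_cases h' : x ≤ φ β
        · exact Or.inl ⟨h, h'⟩
        · exact Or.inr (Or.inr ⟨(not_le.1 h').le, hx.2⟩)
      · exact Or.inr (Or.inl ⟨hx.1, (not_le.1 h).le⟩)
    have hvol : ∫⁻ x in Icc α (φ α) ∪ Icc (φ β) β, g x ≤ ENNReal.ofReal (2 * δ * (β - α)) := by
      calc ∫⁻ x in Icc α (φ α) ∪ Icc (φ β) β, g x
          ≤ ∫⁻ x in Icc α (φ α) ∪ Icc (φ β) β, 1 := lintegral_mono hg1
        _ = volume (Icc α (φ α) ∪ Icc (φ β) β) := by simp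
        _ ≤ ENNReal.ofReal (φ α - α) + ENNReal.ofReal (β - φ β) := by
            refine (measure_union_le _ _).trans (by simp)
        _ ≤ ENNReal.ofReal (δ * (β - α)) + ENNReal.ofReal (δ * (β - α)) := by
            gcongr
            · exact (le_abs_self _).trans hα
            · exact (neg_sub (φ β) β ▸ neg_le_abs _).trans hβ
        _ = ENNReal.ofReal (2 * δ * (β - α)) := by
            have : 0 ≤ δ * (β - α) := (abs_nonneg _).trans hα
            rw [← ENNReal.ofReal_add this this]
            ring_nf
    calc ∫⁻ x in Icc α β, g x
        ≤ ∫⁻ x in Icc (φ α) (φ β) ∪ (Icc α (φ α) ∪ Icc (φ β) β), g x := lintegral_mono_set hsub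
      _ ≤ (∫⁻ x in Icc (φ α) (φ β), g x) + ∫⁻ x in Icc α (φ α) ∪ Icc (φ β) β, g x :=
          lintegral_union_le _ _ _
      _ ≤ (∫⁻ x in Icc α β, g (φ x)) + ENNReal.ofReal (2 * δ * (β - α)) := by
          refine add_le_add ?_ hvol
          rw [← lintegral_map hg hφ]
          exact lintegral_mono' (volume_restrict_image_le_map hαβ.le hφ hmono hanti) le_rfl
  have hne : ENNReal.ofReal (β - α) ≠ 0 := by simpa using hαβ
  unfold unifIcc
  rw [lintegral_smul_measure, lintegral_smul_measure, smul_eq_mul, smul_eq_mul]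
  refine (mul_le_mul_right h1 _).trans ?_
  rw [mul_add]
  refine add_le_add le_rfl ?_
  rw [ENNReal.ofReal_mul' hpos.le, mul_comm, mul_assoc,
    ENNReal.mul_inv_cancel hne ENNReal.ofReal_ne_top, mul_one]

lemma lintegral_unifIcc_translate_le {α β δ s : ℝ} (hαβ : α < β)
    {g : ℝ → ℝ≥0∞} (hg : Measurable g) (hg1 : ∀ x, g x ≤ 1) (hs : |s| ≤ δ * (β - α)) :
    ∫⁻ x, g x ∂unifIcc α β ≤ ∫⁻ x, g (x + s) ∂unifIcc α β + ENNReal.ofReal (2 * δ) := by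
  refine lintegral_unifIcc_le (φ := fun x => x + s) hαβ (by fun_prop)
    (fun x _ y _ h => by simpa using h) (fun x _ y _ _ => by simp) hg hg1 ?_ ?_ <;> simpa using hs

lemma isProbabilityMeasure_unifIcc {α β : ℝ} (h : α < β) :
    IsProbabilityMeasure (unifIcc α β) := by
  refine ⟨?_⟩
  have hne : ENNReal.ofReal (β - α) ≠ 0 := by simpa using h
  simp [unifIcc, ENNReal.inv_mul_cancel hne]

lemma ae_unifIcc {α β : ℝ} : ∀ᵐ x ∂unifIcc α β, x ∈ Icc α β :=
  Measure.ae_smul_measure (ae_restrict_mem measurableSet_Icc) _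

lemma lintegral_le_lintegral_add_const {X : Type*} [MeasurableSpace X] {μ : Measure X}
    [IsProbabilityMeasure μ] {F G : X → ℝ≥0∞} {c : ℝ≥0∞} (h : ∀ᵐ x ∂μ, F x ≤ G x + c) :
    ∫⁻ x, F x ∂μ ≤ ∫⁻ x, G x ∂μ + c := by
  refine (lintegral_mono_ae h).trans ?_
  rw [lintegral_add_right _ measurable_const]
  simp

/-- The iterated logarithm of the ratio of transformed gaps, as a function of `λ₁`. -/
noncomputable def logGapRatio (u₀ u₁ u₂ l : ℝ) : ℝ :=
  Real.log (Real.log ((Real.exp (u₂ * Real.exp l) - Real.exp (u₀ * Real.exp l)) /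
    (Real.exp (u₁ * Real.exp l) - Real.exp (u₀ * Real.exp l))))

lemma exp_secant_mono {u v : ℝ} (hv : 0 < v) (huv : v < u) {a b : ℝ} (ha : a ≠ 0) (hb : b ≠ 0)
    (hab : a ≤ b) :
    (Real.exp (u * a) - 1) / (Real.exp (v * a) - 1) ≤
      (Real.exp (u * b) - 1) / (Real.exp (v * b) - 1) := by
  have hconv := convexOn_rpow (p := u / v) ((one_le_div hv).2 huv.le)
  have hne : ∀ {c : ℝ}, c ≠ 0 → Real.exp (v * c) ≠ 1 := fun hc => by
    simp [Real.exp_eq_one_iff, hv.ne', hc]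
  have hpow : ∀ c : ℝ, Real.exp (v * c) ^ (u / v) = Real.exp (u * c) := fun c => by
    rw [← Real.exp_mul]
    congr 1
    field_simp
  have := hconv.secant_mono (a := 1) (x := Real.exp (v * a)) (y := Real.exp (v * b))
    (by simp) (Real.exp_pos _).le (Real.exp_pos _).le (hne ha) (hne hb)
    (Real.exp_le_exp.2 (mul_le_mul_of_nonneg_left hab hv.le))
  simpa [hpow] using this

lemma gap_ratio_eq {u₀ u₁ u₂ a : ℝ} :
    (Real.exp (u₂ * a) - Real.exp (u₀ * a)) / (Real.exp (u₁ * a) - Real.exp (u₀ * a)) =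
      (Real.exp ((u₂ - u₀) * a) - 1) / (Real.exp ((u₁ - u₀) * a) - 1) := by
  have h : ∀ u, Real.exp (u * a) - Real.exp (u₀ * a) =
      Real.exp (u₀ * a) * (Real.exp ((u - u₀) * a) - 1) := fun u => by
    rw [mul_sub, ← Real.exp_add, mul_one]
    ring_nf
  rw [h, h, mul_div_mul_left _ _ (Real.exp_pos _).ne']

lemma one_lt_exp_gap_ratio {u v a : ℝ} (hv : 0 < v) (huv : v < u) (ha : 0 < a) :
    1 < (Real.exp (u * a) - 1) / (Real.exp (v * a) - 1) := by
  have h1 : 0 < Real.exp (v * a) - 1 := by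
    have := Real.one_lt_exp_iff.2 (mul_pos hv ha); linarith
  rw [one_lt_div h1]
  have := Real.exp_lt_exp.2 (mul_lt_mul_of_pos_right huv ha)
  linarith

lemma monotone_logGapRatio {u₀ u₁ u₂ : ℝ} (h₀ : u₀ < u₁) (h₁ : u₁ < u₂) :
    Monotone (logGapRatio u₀ u₁ u₂) := by
  intro l l' h
  have hv : 0 < u₁ - u₀ := sub_pos.2 h₀
  have huv : u₁ - u₀ < u₂ - u₀ := by linarith
  unfold logGapRatio
  rw [gap_ratio_eq, gap_ratio_eq]
  have h1 := one_lt_exp_gap_ratio hv huv (Real.exp_pos l)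
  refine Real.log_le_log (Real.log_pos h1) (Real.log_le_log (by linarith) ?_)
  exact exp_secant_mono hv huv (Real.exp_pos l).ne' (Real.exp_pos l').ne' (Real.exp_le_exp.2 h)

/-- The quotient of `log ((exp (u a) - 1) / (exp (v a) - 1))` by `a` splits as `u - v` plus a
nonnegative term. -/
lemma log_gap_ratio_div {u v a : ℝ} (hv : 0 < v) (huv : v < u) (ha : 0 < a) :
    Real.log ((Real.exp (u * a) - 1) / (Real.exp (v * a) - 1)) / a =
      (u - v) + Real.log ((Real.exp (u * -a) - 1) / (Real.exp (v * -a) - 1)) / a := by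
  have h : ∀ w, Real.exp (w * -a) - 1 = -(Real.exp (w * a))⁻¹ * (Real.exp (w * a) - 1) :=
    fun w => by
      rw [mul_neg, Real.exp_neg]
      field_simp
      ring
  have hu : 0 < u := hv.trans huv
  have hp : ∀ w, 0 < w → 0 < Real.exp (w * a) - 1 := fun w hw => by
    have := Real.one_lt_exp_iff.2 (mul_pos hw ha); linarith
  have h2 : (Real.exp (u * -a) - 1) / (Real.exp (v * -a) - 1) =
      Real.exp ((v - u) * a) * ((Real.exp (u * a) - 1) / (Real.exp (v * a) - 1)) := by
    rw [h, h, sub_mul, Real.exp_sub]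
    have := (hp v hv).ne'
    field_simp
  rw [h2, Real.log_mul (Real.exp_pos _).ne' (div_pos (hp u hu) (hp v hv)).ne', Real.log_exp]
  field_simp
  ring

lemma one_le_exp_neg_gap_ratio {u v a : ℝ} (hv : 0 < v) (huv : v < u) (ha : 0 < a) :
    1 ≤ (Real.exp (u * -a) - 1) / (Real.exp (v * -a) - 1) := by
  have h1 : Real.exp (v * -a) - 1 < 0 := by
    have : Real.exp (v * -a) < 1 := by
      rw [← Real.exp_zero]
      exact Real.exp_lt_exp.2 (by nlinarith)
    linarith
  rw [one_le_div_of_neg h1]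
  have : Real.exp (u * -a) ≤ Real.exp (v * -a) := Real.exp_le_exp.2 (by nlinarith)
  linarith

lemma logGapRatio_sub {u₀ u₁ u₂ : ℝ} (h₀ : u₀ < u₁) (h₁ : u₁ < u₂) (l : ℝ) :
    logGapRatio u₀ u₁ u₂ l - l = Real.log ((u₂ - u₁) +
      Real.log ((Real.exp ((u₂ - u₀) * -Real.exp l) - 1) /
        (Real.exp ((u₁ - u₀) * -Real.exp l) - 1)) / Real.exp l) := by
  have hv : 0 < u₁ - u₀ := sub_pos.2 h₀
  have huv : u₁ - u₀ < u₂ - u₀ := by linarith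
  have h1 := one_lt_exp_gap_ratio hv huv (Real.exp_pos l)
  have h2 := log_gap_ratio_div hv huv (Real.exp_pos l)
  rw [sub_sub_sub_cancel_right] at h2
  rw [← h2, Real.log_div (Real.log_pos h1).ne' (Real.exp_pos l).ne', Real.log_exp]
  unfold logGapRatio
  rw [gap_ratio_eq]

lemma antitone_logGapRatio_sub {u₀ u₁ u₂ : ℝ} (h₀ : u₀ < u₁) (h₁ : u₁ < u₂) :
    Antitone fun l => logGapRatio u₀ u₁ u₂ l - l := by
  intro l l' h
  have hv : 0 < u₁ - u₀ := sub_pos.2 h₀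
  have huv : u₁ - u₀ < u₂ - u₀ := by linarith
  have h1 := one_le_exp_neg_gap_ratio hv huv (Real.exp_pos l')
  have h2 := one_le_exp_neg_gap_ratio hv huv (Real.exp_pos l)
  have hle := Real.exp_le_exp.2 h
  simp only [logGapRatio_sub h₀ h₁]
  refine Real.log_le_log (add_pos_of_pos_of_nonneg (sub_pos.2 h₁)
    (div_nonneg (Real.log_nonneg h1) (Real.exp_pos _).le)) ?_
  refine add_le_add le_rfl (div_le_div₀ (Real.log_nonneg h2)
    (Real.log_le_log (by linarith) ?_) (Real.exp_pos _) hle)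
  exact exp_secant_mono hv huv (neg_ne_zero.2 (Real.exp_pos _).ne')
    (neg_ne_zero.2 (Real.exp_pos _).ne') (neg_le_neg hle)

lemma abs_logGapRatio_sub_le {u₀ u₁ u₂ : ℝ} (hu₀ : 0 ≤ u₀) (h₀ : u₀ < u₁) (h₁ : u₁ < u₂)
    (hu₂ : u₂ ≤ 1) {l : ℝ} (hl : 0 ≤ l) :
    |logGapRatio u₀ u₁ u₂ l - l| ≤ -Real.log (u₁ - u₀) - Real.log (u₂ - u₁) := by
  have hv : 0 < u₁ - u₀ := sub_pos.2 h₀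
  have hw : 0 < u₂ - u₁ := sub_pos.2 h₁
  have huv : u₁ - u₀ < u₂ - u₀ := by linarith
  have hv1 : Real.log (u₁ - u₀) ≤ 0 := Real.log_nonpos hv.le (by linarith)
  have hw1 : Real.log (u₂ - u₁) ≤ 0 := Real.log_nonpos hw.le (by linarith)
  rw [abs_le]
  constructor
  · rw [logGapRatio_sub h₀ h₁]
    have h1 := one_le_exp_neg_gap_ratio hv huv (Real.exp_pos l)
    have : Real.log (u₂ - u₁) ≤ Real.log ((u₂ - u₁) +
        Real.log ((Real.exp ((u₂ - u₀) * -Real.exp l) - 1) /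
        (Real.exp ((u₁ - u₀) * -Real.exp l) - 1)) / Real.exp l) :=
      Real.log_le_log hw
        (le_add_of_nonneg_right (div_nonneg (Real.log_nonneg h1) (Real.exp_pos _).le))
    linarith
  · have h := antitone_logGapRatio_sub h₀ h₁ hl
    have h1 := one_lt_exp_gap_ratio hv huv one_pos
    have hb : logGapRatio u₀ u₁ u₂ 0 ≤ -Real.log (u₁ - u₀) := by
      unfold logGapRatio
      rw [gap_ratio_eq, Real.exp_zero]
      have hlog := Real.log_pos h1
      have hratio : (Real.exp ((u₂ - u₀) * 1) - 1) / (Real.exp ((u₁ - u₀) * 1) - 1) ≤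
          Real.exp 1 / (u₁ - u₀) := by
        have h2 : u₁ - u₀ ≤ Real.exp ((u₁ - u₀) * 1) - 1 := by
          have := Real.add_one_le_exp ((u₁ - u₀) * 1); linarith
        have h3 : Real.exp ((u₂ - u₀) * 1) ≤ Real.exp 1 := Real.exp_le_exp.2 (by linarith)
        gcongr
        linarith
      have hlog2 := Real.log_le_log (by linarith) hratio
      rw [Real.log_div (Real.exp_pos 1).ne' hv.ne', Real.log_exp] at hlog2
      have := Real.log_le_sub_one_of_pos hlog
      linarith
    simp only [sub_zero] at h
    linarith

lemma measurable_logGapRatio {u₀ u₁ u₂ : ℝ} : Measurable (logGapRatio u₀ u₁ u₂) := by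
  unfold logGapRatio
  fun_prop

/-- A reference configuration of three increasing points determined by the parameters. -/
noncomputable def refVec (l : ℝ × ℝ × ℝ) : Fin 3 → ℝ :=
  ![l.2.2, l.2.2 + Real.exp l.2.1, l.2.2 + Real.exp l.2.1 * Real.exp (Real.exp l.1)]

lemma measurable_refVec : Measurable refVec := by
  refine measurable_pi_iff.2 fun i => ?_
  fin_cases i <;> simp [refVec] <;> fun_prop

lemma measurable_applyMW : Measurable fun p : (ℝ × ℝ × ℝ) × ℝ => applyMW p.1 p.2 := by
  unfold applyMW
  fun_prop

lemma applyMW_eq_refVec {u : Fin 3 → ℝ} (h₀ : u 0 < u 1) (h₁ : u 1 < u 2) (l : ℝ × ℝ × ℝ) :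
    (fun i => applyMW l (u i)) = refVec (logGapRatio (u 0) (u 1) (u 2) l.1,
      l.2.1 + Real.log (Real.exp (u 1 * Real.exp l.1) - Real.exp (u 0 * Real.exp l.1)),
      l.2.2 + Real.exp (u 0 * Real.exp l.1) * Real.exp l.2.1) := by
  have hd : 0 < Real.exp (u 1 * Real.exp l.1) - Real.exp (u 0 * Real.exp l.1) :=
    sub_pos.2 (Real.exp_lt_exp.2 (mul_lt_mul_of_pos_right h₀ (Real.exp_pos _)))
  have h1 := one_lt_exp_gap_ratio (u := u 2 - u 0) (sub_pos.2 h₀) (by linarith) (Real.exp_pos l.1)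
  rw [← gap_ratio_eq] at h1
  funext i
  fin_cases i
  · simp [refVec, applyMW, add_comm]
  · simp [refVec, applyMW, Real.exp_add, Real.exp_log hd]
    ring
  · simp only [refVec, applyMW, Real.exp_add, Real.exp_log hd, logGapRatio,
      Real.exp_log (Real.log_pos h1), Real.exp_log (zero_lt_one.trans h1)]
    have hd' := hd.ne'
    simp only [Fin.reduceFinMk, Matrix.cons_val]
    generalize Real.exp (u 0 * Real.exp l.1) = a₀ at hd' ⊢
    generalize Real.exp (u 1 * Real.exp l.1) = a₁ at hd' ⊢
    field_simp
    ring

lemma iterated_log_bounds {W : ℝ} (hW : Real.exp (Real.exp (Real.exp 1)) ≤ W) :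
    Real.exp 1 ≤ Real.log (Real.log W) ∧ Real.log (Real.log W) ≤ Real.log W ∧
      2 ≤ Real.log W ∧ Real.exp (Real.log (Real.log W)) = Real.log W := by
  have h1 : Real.exp (Real.exp 1) ≤ Real.log W :=
    (Real.le_log_iff_exp_le ((Real.exp_pos _).trans_le hW)).2 hW
  have hL : 0 < Real.log W := (Real.exp_pos _).trans_le h1
  have h2 : Real.exp 1 ≤ Real.log (Real.log W) := (Real.le_log_iff_exp_le hL).2 h1
  have h3 := Real.log_le_sub_one_of_pos hL
  have h4 : (1 : ℝ) + 1 ≤ Real.exp 1 := Real.add_one_le_exp 1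
  exact ⟨h2, by linarith, by linarith, Real.exp_log hL⟩

lemma isProbabilityMeasure_mwParams {W : ℝ} (hW : Real.exp (Real.exp (Real.exp 1)) ≤ W) :
    IsProbabilityMeasure (mwParams W) := by
  obtain ⟨h1, -, h2, -⟩ := iterated_log_bounds hW
  have := Real.exp_pos 1
  have := isProbabilityMeasure_unifIcc
    (show Real.log (Real.log W) < 2 * Real.log (Real.log W) by linarith)
  have := isProbabilityMeasure_unifIcc (show 0 < (Real.log W) ^ 3 by positivity)
  have := isProbabilityMeasure_unifIcc (Real.exp_pos (2 * (Real.log W) ^ 3))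
  unfold mwParams
  infer_instance

lemma abs_log_exp_sub_exp_le {x y a B : ℝ} (hx : 0 ≤ x) (hxy : x < y) (hy : y ≤ 1)
    (ha : 1 ≤ a) (haB : a ≤ B) :
    |Real.log (Real.exp (y * a) - Real.exp (x * a))| ≤ B - Real.log (y - x) := by
  have hv : 0 < y - x := sub_pos.2 hxy
  have hlog : Real.log (y - x) ≤ 0 := Real.log_nonpos hv.le (by linarith)
  have hlow : y - x ≤ Real.exp (y * a) - Real.exp (x * a) := by
    have h1 : Real.exp (y * a) = Real.exp (x * a) * Real.exp ((y - x) * a) := by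
      rw [← Real.exp_add]; ring_nf
    have h2 := Real.add_one_le_exp ((y - x) * a)
    have h3 : 1 ≤ Real.exp (x * a) := Real.one_le_exp (by positivity)
    rw [h1]
    nlinarith [mul_le_mul_of_nonneg_left ha hv.le]
  have hup : Real.log (Real.exp (y * a) - Real.exp (x * a)) ≤ B := by
    rw [Real.log_le_iff_le_exp (hv.trans_le hlow)]
    have h1 : Real.exp (y * a) ≤ Real.exp B := Real.exp_le_exp.2 (by nlinarith)
    have := Real.exp_pos (x * a)
    linarith
  have := Real.log_le_log hv hlow
  rw [abs_le]
  constructor <;> linarith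

lemma lintegral_refVec_le_sorted {W : ℝ} (hW : Real.exp (Real.exp (Real.exp 1)) ≤ W)
    {u : Fin 3 → ℝ} (hu₀ : 0 ≤ u 0) (h₀ : u 0 < u 1) (h₁ : u 1 < u 2) (hu₂ : u 2 ≤ 1)
    {G : (Fin 3 → ℝ) → ℝ≥0∞} (hG : Measurable G) (hG1 : ∀ v, G v ≤ 1) :
    ∫⁻ l, G (refVec l) ∂mwParams W ≤ ∫⁻ l, G (fun i => applyMW l (u i)) ∂mwParams W +
      ENNReal.ofReal (4 / Real.log (Real.log W)) *
        (1 + ENNReal.ofReal (-Real.log (u 1 - u 0)) + ENNReal.ofReal (-Real.log (u 2 - u 1))) := by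
  obtain ⟨hℓ, hℓL, hL, hexp⟩ := iterated_log_bounds hW
  have hℓ0 : 0 < Real.log (Real.log W) := (Real.exp_pos 1).trans_le hℓ
  have hL0 : 0 < Real.log W := by linarith
  have := isProbabilityMeasure_unifIcc
    (show Real.log (Real.log W) < 2 * Real.log (Real.log W) by linarith)
  have := isProbabilityMeasure_unifIcc (show 0 < (Real.log W) ^ 3 by positivity)
  have := isProbabilityMeasure_unifIcc (Real.exp_pos (2 * (Real.log W) ^ 3))
  simp only [applyMW_eq_refVec h₀ h₁]
  unfold mwParams
  set ℓ := Real.log (Real.log W) with hℓdef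
  set L := Real.log W with hLdef
  set U₁ := unifIcc ℓ (2 * ℓ)
  set U₂ := unifIcc 0 (L ^ 3)
  set U₃ := unifIcc 0 (Real.exp (2 * L ^ 3))
  have hGm : Measurable fun l => G (refVec l) := hG.comp measurable_refVec
  have hφ : Measurable (logGapRatio (u 0) (u 1) (u 2)) := measurable_logGapRatio
  set φ := logGapRatio (u 0) (u 1) (u 2)
  have hs₂ : Measurable fun l : ℝ =>
      Real.log (Real.exp (u 1 * Real.exp l) - Real.exp (u 0 * Real.exp l)) := by fun_prop
  set s₂ : ℝ → ℝ := fun l =>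
    Real.log (Real.exp (u 1 * Real.exp l) - Real.exp (u 0 * Real.exp l))
  have hm : Measurable fun l : ℝ × ℝ × ℝ => G (refVec (φ l.1, l.2.1 + s₂ l.1,
      l.2.2 + Real.exp (u 0 * Real.exp l.1) * Real.exp l.2.1)) :=
    hGm.comp (by fun_prop)
  set V := -Real.log (u 1 - u 0) with hV
  set X := -Real.log (u 2 - u 1) with hX
  have hV0 : 0 ≤ V := neg_nonneg.2 (Real.log_nonpos (by linarith) (by linarith))
  have hX0 : 0 ≤ X := neg_nonneg.2 (Real.log_nonpos (by linarith) (by linarith))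
  have hexpL : ∀ l ∈ Icc ℓ (2 * ℓ), Real.exp l ≤ L ^ 2 := fun l hl => by
    rw [← hexp, ← Real.exp_nat_mul]
    exact Real.exp_le_exp.2 (by simpa using hl.2)
  -- replace the location parameter
  have step₃ : ∀ l₁ ∈ Icc ℓ (2 * ℓ), ∀ l₂ ∈ Icc 0 (L ^ 3), ∀ t r,
      ∫⁻ l₃, G (refVec (t, r, l₃)) ∂U₃ ≤
      ∫⁻ l₃, G (refVec (t, r, l₃ + Real.exp (u 0 * Real.exp l₁) * Real.exp l₂)) ∂U₃ +
        ENNReal.ofReal (2 * (1 / ℓ)) := by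
    intro l₁ hl₁ l₂ hl₂ t r
    refine lintegral_unifIcc_translate_le (g := fun l₃ => G (refVec (t, r, l₃)))
      (Real.exp_pos _) (hGm.comp (by fun_prop)) (fun _ => hG1 _) ?_
    rw [← Real.exp_add, abs_of_pos (Real.exp_pos _), sub_zero]
    have h1 : u 0 * Real.exp l₁ ≤ L ^ 2 := by
      have := hexpL l₁ hl₁
      have := Real.exp_pos l₁
      nlinarith
    have h2 : L ≤ L ^ 3 - L ^ 2 := by nlinarith [mul_pos hL0 hL0]
    have h3 : Real.exp L * Real.exp (u 0 * Real.exp l₁ + l₂) ≤ Real.exp (2 * L ^ 3) := by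
      rw [← Real.exp_add]
      exact Real.exp_le_exp.2 (by linarith [hl₂.2])
    have h4 : ℓ ≤ Real.exp L := by linarith [Real.add_one_le_exp L]
    rw [one_div, inv_mul_eq_div, le_div_iff₀ hℓ0, mul_comm]
    exact (mul_le_mul_of_nonneg_right h4 (Real.exp_pos _).le).trans h3
  -- replace the scale parameter
  have step₂ : ∀ l₁ ∈ Icc ℓ (2 * ℓ), ∀ t,
      ∫⁻ l₂, ∫⁻ l₃, G (refVec (t, l₂, l₃)) ∂U₃ ∂U₂ ≤
      ∫⁻ l₂, ∫⁻ l₃, G (refVec (t, l₂ + s₂ l₁, l₃)) ∂U₃ ∂U₂ +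
        ENNReal.ofReal (2 * ((1 + V) / ℓ)) := by
    intro l₁ hl₁ t
    refine lintegral_unifIcc_translate_le (g := fun l₂ => ∫⁻ l₃, G (refVec (t, l₂, l₃)) ∂U₃)
      (by positivity) ?_ (fun l₂ => ?_) ?_
    · exact (hGm.comp (g := fun l => G (refVec l)) (f := fun p : ℝ × ℝ => (t, p.1, p.2))
        (by fun_prop)).lintegral_prod_right'
    · exact (lintegral_mono fun _ => hG1 _).trans (by simp)
    · have h1 := abs_log_exp_sub_exp_le hu₀ h₀ (h₁.le.trans hu₂)
        (Real.one_le_exp (hℓ0.le.trans hl₁.1)) (hexpL l₁ hl₁)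
      refine h1.trans ?_
      rw [sub_zero, div_mul_eq_mul_div, le_div_iff₀ hℓ0, sub_eq_add_neg]
      have h2 : 1 ≤ L ^ 2 := by nlinarith
      calc (L ^ 2 + V) * ℓ ≤ (L ^ 2 * (1 + V)) * L := by
            gcongr
            nlinarith
        _ = (1 + V) * L ^ 3 := by ring
  -- replace the exponent parameter
  have step₁ : ∫⁻ l₁, ∫⁻ l₂, ∫⁻ l₃, G (refVec (l₁, l₂, l₃)) ∂U₃ ∂U₂ ∂U₁ ≤
      ∫⁻ l₁, ∫⁻ l₂, ∫⁻ l₃, G (refVec (φ l₁, l₂, l₃)) ∂U₃ ∂U₂ ∂U₁ +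
        ENNReal.ofReal (2 * ((V + X) / ℓ)) := by
    have hb : ∀ l, ℓ ≤ l → |φ l - l| ≤ (V + X) / ℓ * (2 * ℓ - ℓ) := fun l hl => by
      have h1 := abs_logGapRatio_sub_le hu₀ h₀ h₁ hu₂ (hℓ0.le.trans hl)
      have h2 : (V + X) / ℓ * (2 * ℓ - ℓ) = V + X := by field_simp; ring
      rw [h2]
      linarith
    refine lintegral_unifIcc_le
      (g := fun l₁ => ∫⁻ l₂, ∫⁻ l₃, G (refVec (l₁, l₂, l₃)) ∂U₃ ∂U₂) (by linarith) hφ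
      ((monotone_logGapRatio h₀ h₁).monotoneOn _) ((antitone_logGapRatio_sub h₀ h₁).antitoneOn _)
      ?_ (fun l₁ => ?_) (hb _ le_rfl) (hb _ (by linarith))
    · refine Measurable.lintegral_prod_right' (f := fun p : ℝ × ℝ =>
        ∫⁻ l₃, G (refVec (p.1, p.2, l₃)) ∂U₃) ?_
      exact (hGm.comp (g := fun l => G (refVec l))
        (f := fun p : (ℝ × ℝ) × ℝ => (p.1.1, p.1.2, p.2)) (by fun_prop)).lintegral_prod_right'
    · refine (lintegral_mono fun _ => lintegral_mono fun _ => hG1 _).trans (by simp)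
  rw [lintegral_prod _ hGm.aemeasurable, lintegral_prod _ hm.aemeasurable]
  have e₁ : ∀ l₁, ∫⁻ p, G (refVec (l₁, p)) ∂U₂.prod U₃ =
      ∫⁻ l₂, ∫⁻ l₃, G (refVec (l₁, l₂, l₃)) ∂U₃ ∂U₂ := fun l₁ =>
    lintegral_prod _ (hGm.comp (by fun_prop)).aemeasurable
  have e₂ : ∀ l₁, ∫⁻ p : ℝ × ℝ, G (refVec (φ l₁, p.1 + s₂ l₁,
        p.2 + Real.exp (u 0 * Real.exp l₁) * Real.exp p.1)) ∂U₂.prod U₃ =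
      ∫⁻ l₂, ∫⁻ l₃, G (refVec (φ l₁, l₂ + s₂ l₁,
        l₃ + Real.exp (u 0 * Real.exp l₁) * Real.exp l₂)) ∂U₃ ∂U₂ := fun l₁ =>
    lintegral_prod _ (hGm.comp (by fun_prop)).aemeasurable
  simp only [e₁, e₂]
  have step : ∫⁻ l₁, ∫⁻ l₂, ∫⁻ l₃, G (refVec (φ l₁, l₂, l₃)) ∂U₃ ∂U₂ ∂U₁ ≤
      ∫⁻ l₁, ∫⁻ l₂, ∫⁻ l₃, G (refVec (φ l₁, l₂ + s₂ l₁,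
        l₃ + Real.exp (u 0 * Real.exp l₁) * Real.exp l₂)) ∂U₃ ∂U₂ ∂U₁ +
      (ENNReal.ofReal (2 * (1 / ℓ)) + ENNReal.ofReal (2 * ((1 + V) / ℓ))) := by
    refine lintegral_le_lintegral_add_const ?_
    filter_upwards [ae_unifIcc] with l₁ hl₁
    refine (step₂ l₁ hl₁ (φ l₁)).trans ?_
    rw [← add_assoc]
    refine add_le_add ?_ le_rfl
    refine lintegral_le_lintegral_add_const ?_
    filter_upwards [ae_unifIcc] with l₂ hl₂
    exact step₃ l₁ hl₁ l₂ hl₂ _ _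
  refine step₁.trans ((add_le_add step le_rfl).trans ?_)
  rw [add_assoc]
  refine add_le_add le_rfl ?_
  rw [← ENNReal.ofReal_one, ← ENNReal.ofReal_add (by positivity) (by positivity),
    ← ENNReal.ofReal_add (by positivity) (by positivity),
    ← ENNReal.ofReal_add (by positivity) (by positivity),
    ← ENNReal.ofReal_add (by positivity) (by positivity),
    ← ENNReal.ofReal_mul (by positivity)]
  refine ENNReal.ofReal_le_ofReal ?_
  have : 2 * (1 / ℓ) + 2 * ((1 + V) / ℓ) + 2 * ((V + X) / ℓ) = (4 + 4 * V + 2 * X) / ℓ := by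
    field_simp
    ring
  rw [this, div_mul_eq_mul_div]
  gcongr
  linarith

/-- `F` and `F'` are within `ε` of each other when tested against `[0, 1]`-valued functions. -/
def TestLe {Ω E : Type*} [MeasurableSpace Ω] [MeasurableSpace E] (P : Measure Ω) (F F' : Ω → E)
    (ε : ℝ≥0∞) : Prop :=
  ∀ G : E → ℝ≥0∞, Measurable G → (∀ v, G v ≤ 1) →
    ∫⁻ l, G (F l) ∂P ≤ ∫⁻ l, G (F' l) ∂P + ε

lemma TestLe.symm {Ω E : Type*} [MeasurableSpace Ω] [MeasurableSpace E] {P : Measure Ω}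
    [IsProbabilityMeasure P] {F F' : Ω → E} (hF : Measurable F) (hF' : Measurable F') {ε : ℝ≥0∞}
    (h : TestLe P F F' ε) : TestLe P F' F ε := by
  intro G hG hG1
  have hsum : ∀ F : Ω → E, Measurable F →
      ∫⁻ l, G (F l) ∂P + ∫⁻ l, (1 - G (F l)) ∂P = 1 := fun F hF => by
    rw [← lintegral_add_left (by fun_prop : Measurable fun l => G (F l))]
    simp [add_tsub_cancel_of_le (hG1 _)]
  have h1 := h (fun v => 1 - G v) (measurable_const.sub hG) (fun v => tsub_le_self)
  have hfin : ∫⁻ l, (1 - G (F' l)) ∂P ≠ ⊤ :=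
    ((le_add_self.trans (hsum F' hF').le).trans_lt ENNReal.one_lt_top).ne
  refine (ENNReal.add_le_add_iff_right hfin).1 ?_
  calc _ = ∫⁻ l, G (F l) ∂P + ∫⁻ l, (1 - G (F l)) ∂P := by rw [hsum F' hF', hsum F hF]
    _ ≤ ∫⁻ l, G (F l) ∂P + (∫⁻ l, (1 - G (F' l)) ∂P + ε) := add_le_add le_rfl h1
    _ = _ := by ring

lemma TestLe.prod {Ω E : Type*} [MeasurableSpace Ω] [MeasurableSpace E] {P : Measure Ω}
    [IsProbabilityMeasure P] {F F' J J' : Ω → E} (hF : Measurable F) (hF' : Measurable F')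
    (hJ : Measurable J) (hJ' : Measurable J') {ε ε' : ℝ≥0∞}
    (h : TestLe P F F' ε) (h' : TestLe P J J' ε') :
    TestLe (P.prod P) (fun ω => (F ω.1, J ω.2)) (fun ω => (F' ω.1, J' ω.2)) (ε + ε') := by
  intro G hG hG1
  rw [lintegral_prod _ (by fun_prop), lintegral_prod_symm _ (by fun_prop), add_comm ε, ← add_assoc]
  have h1 : ∫⁻ a, ∫⁻ b, G (F a, J b) ∂P ∂P ≤ ∫⁻ a, ∫⁻ b, G (F a, J' b) ∂P ∂P + ε' :=
    lintegral_le_lintegral_add_const (.of_forall fun a =>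
      h' (fun v => G (F a, v)) (by fun_prop) fun v => hG1 _)
  have h2 : ∫⁻ b, ∫⁻ a, G (F a, J' b) ∂P ∂P ≤ ∫⁻ b, ∫⁻ a, G (F' a, J' b) ∂P ∂P + ε :=
    lintegral_le_lintegral_add_const (.of_forall fun b =>
      h (fun v => G (v, J' b)) (by fun_prop) fun v => hG1 _)
  have h3 : ∫⁻ a, ∫⁻ b, G (F a, J' b) ∂P ∂P = ∫⁻ b, ∫⁻ a, G (F a, J' b) ∂P ∂P :=
    lintegral_lintegral_swap (by unfold Function.uncurry; fun_prop)
  rw [h3] at h1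
  calc _ ≤ ∫⁻ b, ∫⁻ a, G (F a, J' b) ∂P ∂P + ε' := h1
    _ ≤ (∫⁻ b, ∫⁻ a, G (F' a, J' b) ∂P ∂P + ε) + ε' := add_le_add h2 le_rfl
    _ = _ := by ring

/-- The outcomes of the three pairwise comparisons of a triple. -/
def cmpBits {α : Type*} [LT α] [DecidableLT α] (x : Fin 3 → α) : Bool × Bool × Bool :=
  (decide (x 0 < x 1), decide (x 0 < x 2), decide (x 1 < x 2))

/-- The ranks of the entries of a triple with the given pairwise comparisons. -/
def rankOf (p : Bool × Bool × Bool) : Fin 3 → Fin 3 :=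
  ![(bif p.1 then 0 else 1) + bif p.2.1 then 0 else 1,
    (bif p.1 then 1 else 0) + bif p.2.2 then 0 else 1,
    (bif p.2.1 then 1 else 0) + bif p.2.2 then 1 else 0]

/-- The negative part of the logarithm, infinite at the origin. -/
noncomputable def negLog (d : ℝ) : ℝ≥0∞ := if d = 0 then ⊤ else ENNReal.ofReal (-Real.log d)

lemma negLog_neg (d : ℝ) : negLog (-d) = negLog d := by simp [negLog]

lemma measurable_negLog : Measurable negLog :=
  Measurable.ite (measurableSet_singleton 0) measurable_const (by fun_prop)

/-- The total penalty for small gaps between the entries of a triple. -/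
noncomputable def gapPenalty (x : Fin 3 → ℝ) : ℝ≥0∞ :=
  negLog (x 0 - x 1) + negLog (x 0 - x 2) + negLog (x 1 - x 2)

lemma measurable_gapPenalty : Measurable gapPenalty := by
  unfold gapPenalty
  have := measurable_negLog
  fun_prop

lemma testLe_refVec_sorted {W : ℝ} (hW : Real.exp (Real.exp (Real.exp 1)) ≤ W)
    {x : Fin 3 → ℝ} (hx : ∀ i, x i ∈ Icc (0 : ℝ) 1) {i j k : Fin 3} (hij : x i < x j)
    (hjk : x j < x k) {r : Fin 3 → Fin 3} (hr : ∀ a, x a = ![x i, x j, x k] (r a))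
    (hpen : negLog (x i - x j) + negLog (x j - x k) ≤ gapPenalty x) :
    TestLe (mwParams W) (fun l a => refVec l (r a)) (fun l a => applyMW l (x a))
      (ENNReal.ofReal (4 / Real.log (Real.log W)) * (1 + gapPenalty x)) := by
  intro G hG hG1
  have h := lintegral_refVec_le_sorted hW (u := ![x i, x j, x k]) (hx i).1 hij hjk (hx k).2
    (G := fun v => G fun a => v (r a))
    (hG.comp (measurable_pi_iff.2 fun a => measurable_pi_apply _)) fun v => hG1 _
  simp only [← hr] at h
  refine h.trans ?_
  refine add_le_add le_rfl (mul_le_mul_right ?_ _)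
  rw [add_assoc]
  refine add_le_add le_rfl (le_trans (le_of_eq ?_) hpen)
  have h1 : x i - x j ≠ 0 := by linarith
  have h2 : x j - x k ≠ 0 := by linarith
  simp only [negLog, h1, h2, if_false]
  rw [← Real.log_neg_eq_log (x i - x j), ← Real.log_neg_eq_log (x j - x k), neg_sub, neg_sub]
  rfl

lemma testLe_refVec {W : ℝ} (hW : Real.exp (Real.exp (Real.exp 1)) ≤ W)
    {x : Fin 3 → ℝ} (hx : ∀ i, x i ∈ Icc (0 : ℝ) 1) :
    TestLe (mwParams W) (fun l a => refVec l (rankOf (cmpBits x) a)) (fun l a => applyMW l (x a))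
      (ENNReal.ofReal (4 / Real.log (Real.log W)) * (1 + gapPenalty x)) := by
  have hℓ0 : 0 < Real.log (Real.log W) := (Real.exp_pos 1).trans_le (iterated_log_bounds hW).1
  have htop : gapPenalty x = ⊤ → TestLe (mwParams W) (fun l a => refVec l (rankOf (cmpBits x) a))
      (fun l a => applyMW l (x a))
      (ENNReal.ofReal (4 / Real.log (Real.log W)) * (1 + gapPenalty x)) := fun h G _ _ => by
    have : ENNReal.ofReal (4 / Real.log (Real.log W)) ≠ 0 := by
      simp only [ne_eq, ENNReal.ofReal_eq_zero, not_le]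
      positivity
    simp [h, ENNReal.mul_top this]
  have n01 : negLog (x 1 - x 0) = negLog (x 0 - x 1) := by rw [← negLog_neg, neg_sub]
  have n02 : negLog (x 2 - x 0) = negLog (x 0 - x 2) := by rw [← negLog_neg, neg_sub]
  have n12 : negLog (x 2 - x 1) = negLog (x 1 - x 2) := by rw [← negLog_neg, neg_sub]
  by_cases h01 : x 0 = x 1
  · exact htop (by simp [gapPenalty, negLog, h01])
  by_cases h02 : x 0 = x 2
  · exact htop (by simp [gapPenalty, negLog, h02])
  by_cases h12 : x 1 = x 2
  · exact htop (by simp [gapPenalty, negLog, h12])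
  have hsorted : ∃ i j k : Fin 3, x i < x j ∧ x j < x k ∧
      (∀ a, x a = ![x i, x j, x k] (rankOf (cmpBits x) a)) ∧
      negLog (x i - x j) + negLog (x j - x k) ≤ gapPenalty x := by
    have hpen : ∀ a b c : ℝ≥0∞, a + b ≤ a + b + c ∧ a + c ≤ a + b + c ∧ b + c ≤ a + b + c ∧
        b + a ≤ a + b + c ∧ c + a ≤ a + b + c ∧ c + b ≤ a + b + c := fun a b c => by
      rw [add_comm b a, add_comm c a, add_comm c b]
      exact ⟨le_self_add, add_le_add le_self_add le_rfl, add_le_add le_add_self le_rfl,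
        le_self_add, add_le_add le_self_add le_rfl, add_le_add le_add_self le_rfl⟩
    unfold gapPenalty
    obtain ⟨p1, p2, p3, p4, p5, p6⟩ :=
      hpen (negLog (x 0 - x 1)) (negLog (x 0 - x 2)) (negLog (x 1 - x 2))
    have hr : ∀ {p : Bool × Bool × Bool} {v : Fin 3 → ℝ}, cmpBits x = p →
        (∀ a, x a = v (rankOf p a)) → ∀ a, x a = v (rankOf (cmpBits x) a) := fun h h' => h ▸ h'
    rcases lt_or_gt_of_ne h01 with g01 | g01 <;> rcases lt_or_gt_of_ne h02 with g02 | g02 <;>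
      rcases lt_or_gt_of_ne h12 with g12 | g12
    · refine ⟨0, 1, 2, g01, g12, hr (p := (true, true, true)) ?_ ?_, p2⟩
      · simp [cmpBits, g01, g02, g12]
      · intro a; fin_cases a <;> rfl
    · refine ⟨0, 2, 1, g02, g12, hr (p := (true, true, false)) ?_ ?_, ?_⟩
      · simp [cmpBits, g01, g02, g12.le]
      · intro a; fin_cases a <;> rfl
      · rwa [n12]
    · linarith
    · refine ⟨2, 0, 1, g02, g01, hr (p := (true, false, false)) ?_ ?_, ?_⟩
      · simp [cmpBits, g01, g02.le, g12.le]
      · intro a; fin_cases a <;> rfl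
      · rwa [n02]
    · refine ⟨1, 0, 2, g01, g02, hr (p := (false, true, true)) ?_ ?_, ?_⟩
      · simp [cmpBits, g01.le, g02, g12]
      · intro a; fin_cases a <;> rfl
      · rwa [n01]
    · linarith
    · refine ⟨1, 2, 0, g12, g02, hr (p := (false, false, true)) ?_ ?_, ?_⟩
      · simp [cmpBits, g01.le, g02.le, g12]
      · intro a; fin_cases a <;> rfl
      · rwa [n02]
    · refine ⟨2, 1, 0, g12, g01, hr (p := (false, false, false)) ?_ ?_, ?_⟩
      · simp [cmpBits, g01.le, g02.le, g12.le]
      · intro a; fin_cases a <;> rfl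
      · rwa [n01, n12]
  obtain ⟨i, j, k, hij, hjk, hr, hpen⟩ := hsorted
  exact testLe_refVec_sorted hW hx hij hjk hr hpen

lemma pi_smul_sum {ι κ X : Type*} [Fintype ι] [DecidableEq ι] [Fintype κ] [MeasurableSpace X]
    {w : ℝ≥0∞}
    (hw : w ≠ ⊤) (ν : ι → κ → Measure X) [∀ i k, IsFiniteMeasure (ν i k)] :
    Measure.pi (fun i => w • ∑ k, ν i k) =
      w ^ Fintype.card ι • ∑ j : ι → κ, Measure.pi fun i => ν i (j i) := by
  have : ∀ i, IsFiniteMeasure (w • ∑ k, ν i k) := fun i => Measure.smul_finite _ hw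
  refine Measure.pi_eq fun s hs => ?_
  simp only [Measure.smul_apply, Measure.finsetSum_apply, smul_eq_mul, Measure.pi_pi,
    Finset.prod_mul_distrib, Finset.prod_const, Finset.card_univ, Finset.prod_univ_sum,
    Fintype.piFinset_univ]

lemma measurePreserving_tail {X : Type*} [MeasurableSpace X] {m : ℕ}
    (μ : Fin (m + 1) → Measure X) [∀ i, IsProbabilityMeasure (μ i)] :
    MeasurePreserving (fun z : Fin (m + 1) → X => Fin.tail z) (Measure.pi μ)
      (Measure.pi fun i => μ i.succ) :=
  measurePreserving_snd.comp (measurePreserving_piFinSuccAbove μ 0)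

/-- The edge distribution with a given label. -/
noncomputable def edgeDist (c : Bool) : Measure (ℝ × ℝ) := if c then rDist else tDist

instance : IsProbabilityMeasure tDist := by
  have : IsProbabilityMeasure (volume.restrict (Icc (0 : ℝ) 1)) := ⟨by simp⟩
  exact Measure.isProbabilityMeasure_map
    (Measurable.ite measurableSet_Iic (by fun_prop) (by fun_prop)).aemeasurable

instance : IsProbabilityMeasure rDist := by
  have : IsProbabilityMeasure (volume.restrict (Icc (0 : ℝ) 1)) := ⟨by simp⟩
  exact Measure.isProbabilityMeasure_map
    (Measurable.ite measurableSet_Iic (by fun_prop) (by fun_prop)).aemeasurable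

instance (c : Bool) : IsProbabilityMeasure (edgeDist c) := by
  cases c <;> simp only [edgeDist] <;> infer_instance

/-- The uniform distribution on the boundary of the square. -/
noncomputable def squareDist : Measure (ℝ × ℝ) := (2 : ℝ≥0∞)⁻¹ • (tDist + rDist)

lemma squareDist_eq : squareDist = (2 : ℝ≥0∞)⁻¹ • ∑ c, edgeDist c := by
  simp [squareDist, edgeDist, add_comm]

instance : IsProbabilityMeasure squareDist := ⟨by
  simp [squareDist, ENNReal.inv_two_add_inv_two]⟩

lemma labeledSamples_eq (m : ℕ) (p q : Measure (ℝ × ℝ)) :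
    labeledSamples m p q = ((2 : ℝ≥0∞) ^ m)⁻¹ • ∑ b : Fin m → Bool,
      (Measure.pi fun i => if b i then q else p).map fun xs => (xs, b) := by
  ext s hs
  rw [labeledSamples, Measure.bind_apply hs (Measurable.of_discrete).aemeasurable,
    lintegral_fintype]
  simp [PMF.uniformOfFintype_apply, Finset.mul_sum, mul_comm]

instance (m : ℕ) (p q : Measure (ℝ × ℝ)) [IsProbabilityMeasure p] [IsProbabilityMeasure q] :
    IsProbabilityMeasure (labeledSamples m p q) := ⟨by
  have : ∀ b : Fin m → Bool, ∀ i, IsProbabilityMeasure (if b i then q else p) := fun b i => by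
    split_ifs <;> infer_instance
  have h : ∀ b : Fin m → Bool, ((Measure.pi fun i => if b i then q else p).map
      fun xs => (xs, b)) univ = 1 := fun b => by
    rw [Measure.map_apply (by fun_prop) .univ]
    simp
  rw [labeledSamples_eq]
  simp only [Measure.smul_apply, Measure.finsetSum_apply, h]
  simp [ENNReal.inv_mul_cancel]⟩

lemma lintegral_labeledSamples {m : ℕ} (p q : Measure (ℝ × ℝ))
    {H : (Fin m → ℝ × ℝ) × (Fin m → Bool) → ℝ≥0∞} (hH : Measurable H) :
    ∫⁻ z, H z ∂labeledSamples m p q = ((2 : ℝ≥0∞) ^ m)⁻¹ * ∑ b : Fin m → Bool,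
      ∫⁻ z, H (z, b) ∂Measure.pi fun i => if b i then q else p := by
  rw [labeledSamples_eq, lintegral_smul_measure, lintegral_finsetSum_measure, smul_eq_mul]
  congr 1
  exact Finset.sum_congr rfl fun b _ => lintegral_map hH (by fun_prop)

lemma lintegral_labeledSamples_edge {m : ℕ}
    {H : (Fin m → ℝ × ℝ) × (Fin m → Bool) → ℝ≥0∞} (hH : Measurable H) :
    ∫⁻ z, H z ∂labeledSamples m tDist rDist = ((2 : ℝ≥0∞) ^ m)⁻¹ * ∑ b : Fin m → Bool,
      ∫⁻ z, H (z, b) ∂Measure.pi fun i => edgeDist (b i) :=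
  lintegral_labeledSamples _ _ hH

lemma lintegral_labeledSamples_edge_swap {m : ℕ}
    {H : (Fin m → ℝ × ℝ) × (Fin m → Bool) → ℝ≥0∞} (hH : Measurable H) :
    ∫⁻ z, H z ∂labeledSamples m rDist tDist = ((2 : ℝ≥0∞) ^ m)⁻¹ * ∑ b : Fin m → Bool,
      ∫⁻ z, H (z, b) ∂Measure.pi fun i => edgeDist (!b i) := by
  rw [lintegral_labeledSamples _ _ hH]
  have : ∀ c : Bool, (if c then tDist else rDist) = edgeDist (!c) := fun c => by
    cases c <;> rfl
  simp only [this]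

lemma lintegral_labeledSamples_square {m : ℕ}
    {H : (Fin m → ℝ × ℝ) × (Fin m → Bool) → ℝ≥0∞} (hH : Measurable H) :
    ∫⁻ z, H z ∂labeledSamples m squareDist squareDist = ((2 : ℝ≥0∞) ^ m)⁻¹ *
      ∑ b : Fin m → Bool, ((2 : ℝ≥0∞) ^ m)⁻¹ * ∑ c : Fin m → Bool,
        ∫⁻ z, H (z, b) ∂Measure.pi fun i => edgeDist (c i) := by
  rw [lintegral_labeledSamples _ _ hH]
  simp only [ite_self, squareDist_eq]
  rw [pi_smul_sum (by simp) fun _ k => edgeDist k]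
  simp only [lintegral_smul_measure, lintegral_finsetSum_measure, smul_eq_mul, Fintype.card_fin,
    ENNReal.inv_pow]

/-- The two-sided mixture of labeled samples from `(t, r)` and `(r, t)`. -/
noncomputable def mixedSamples (m : ℕ) : Measure ((Fin m → ℝ × ℝ) × (Fin m → Bool)) :=
  (2 : ℝ≥0∞)⁻¹ • (labeledSamples m tDist rDist + labeledSamples m rDist tDist)

instance (m : ℕ) : IsProbabilityMeasure (mixedSamples m) := ⟨by
  simp [mixedSamples, ENNReal.inv_two_add_inv_two]⟩

lemma lintegral_mixedSamples {m : ℕ}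
    {H : (Fin m → ℝ × ℝ) × (Fin m → Bool) → ℝ≥0∞} (hH : Measurable H) :
    ∫⁻ z, H z ∂mixedSamples m = ((2 : ℝ≥0∞) ^ m)⁻¹ *
      ∑ b : Fin m → Bool, (2 : ℝ≥0∞)⁻¹ * (∫⁻ z, H (z, b) ∂Measure.pi (fun i => edgeDist (b i)) +
        ∫⁻ z, H (z, b) ∂Measure.pi fun i => edgeDist (!b i)) := by
  rw [mixedSamples, lintegral_smul_measure, lintegral_add_measure, smul_eq_mul,
    lintegral_labeledSamples_edge hH, lintegral_labeledSamples_edge_swap hH, ← mul_add,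
    ← Finset.sum_add_distrib, ← Finset.mul_sum]
  ring

/-- Tests whose averages agree on complementary pairs of labelings do not distinguish the
two sampling procedures. -/
lemma lintegral_labeledSamples_square_eq_mixedSamples {m : ℕ}
    {H : (Fin m → ℝ × ℝ) × (Fin m → Bool) → ℝ≥0∞} (hH : Measurable H)
    (h : ∀ b c c' : Fin m → Bool, ∫⁻ z, H (z, b) ∂Measure.pi (fun i => edgeDist (c i)) +
        ∫⁻ z, H (z, b) ∂Measure.pi (fun i => edgeDist (!c i)) =
      ∫⁻ z, H (z, b) ∂Measure.pi (fun i => edgeDist (c' i)) +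
        ∫⁻ z, H (z, b) ∂Measure.pi (fun i => edgeDist (!c' i))) :
    ∫⁻ z, H z ∂labeledSamples m squareDist squareDist = ∫⁻ z, H z ∂mixedSamples m := by
  rw [lintegral_labeledSamples_square hH, lintegral_mixedSamples hH]
  congr 1
  refine Finset.sum_congr rfl fun b _ => ?_
  set I : (Fin m → Bool) → ℝ≥0∞ := fun c => ∫⁻ z, H (z, b) ∂Measure.pi fun i => edgeDist (c i)
    with hI
  have hcompl : ∑ c : Fin m → Bool, I (fun i => !c i) = ∑ c, I c :=
    (Equiv.arrowCongr (Equiv.refl (Fin m)) Equiv.boolNot).sum_comp I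
  have hsum : 2 * ∑ c, I c = 2 ^ m * (I b + I fun i => !b i) := by
    calc 2 * ∑ c, I c = ∑ c, (I c + I fun i => !c i) := by
          rw [Finset.sum_add_distrib, hcompl, two_mul]
      _ = ∑ c : Fin m → Bool, (I b + I fun i => !b i) :=
          Finset.sum_congr rfl fun c _ => h b c b
      _ = _ := by simp [mul_add]
  have h2 : (2 : ℝ≥0∞)⁻¹ * 2 = 1 := ENNReal.inv_mul_cancel (by simp) (by simp)
  have hm : ((2 : ℝ≥0∞) ^ m)⁻¹ * 2 ^ m = 1 := ENNReal.inv_mul_cancel (by simp) (by simp)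
  calc ((2 : ℝ≥0∞) ^ m)⁻¹ * ∑ c, I c
      = ((2 : ℝ≥0∞) ^ m)⁻¹ * (((2 : ℝ≥0∞)⁻¹ * 2) * ∑ c, I c) := by rw [h2, one_mul]
    _ = ((2 : ℝ≥0∞) ^ m)⁻¹ * ((2 : ℝ≥0∞)⁻¹ * (2 * ∑ c, I c)) := by ring
    _ = (((2 : ℝ≥0∞) ^ m)⁻¹ * 2 ^ m) * ((2 : ℝ≥0∞)⁻¹ * (I b + I fun i => !b i)) := by
        rw [hsum]; ring
    _ = _ := by rw [hm, one_mul]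

lemma labeledSamples_one_square_eq_mixedSamples :
    labeledSamples 1 squareDist squareDist = mixedSamples 1 := by
  refine Measure.ext_of_lintegral _ fun H hH =>
    lintegral_labeledSamples_square_eq_mixedSamples hH fun b c c' => ?_
  have hc : c = c' ∨ c = fun i => !c' i := by
    rcases Bool.eq_or_eq_not (c 0) (c' 0) with h | h
    · exact .inl (funext fun i => by rwa [Subsingleton.elim i 0])
    · exact .inr (funext fun i => by rwa [Subsingleton.elim i 0])
  rcases hc with rfl | rfl
  · rfl
  · simp only [Bool.not_not]
    rw [add_comm]

/-- Forgetting the first of a sequence of labeled samples. -/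
def dropFirst {m : ℕ} (z : (Fin (m + 1) → ℝ × ℝ) × (Fin (m + 1) → Bool)) :
    (Fin m → ℝ × ℝ) × (Fin m → Bool) :=
  (Fin.tail z.1, Fin.tail z.2)

lemma measurable_dropFirst {m : ℕ} : Measurable (dropFirst (m := m)) := by
  unfold dropFirst Fin.tail
  fun_prop

lemma map_dropFirst_labeledSamples (m : ℕ) (p q : Measure (ℝ × ℝ)) [IsProbabilityMeasure p]
    [IsProbabilityMeasure q] :
    (labeledSamples (m + 1) p q).map dropFirst = labeledSamples m p q := by
  refine Measure.ext_of_lintegral _ fun H hH => ?_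
  have hH' : Measurable fun z => H (dropFirst (m := m) z) := hH.comp measurable_dropFirst
  rw [lintegral_map hH measurable_dropFirst, lintegral_labeledSamples _ _ hH',
    lintegral_labeledSamples _ _ hH]
  have h : ∀ b : Fin (m + 1) → Bool,
      ∫⁻ z, H (dropFirst (z, b)) ∂Measure.pi (fun i => if b i then q else p) =
        ∫⁻ z, H (z, Fin.tail b) ∂Measure.pi fun i => if Fin.tail b i then q else p := fun b => by
    have : ∀ i, IsProbabilityMeasure (if b i then q else p) := fun i => by
      split_ifs <;> infer_instance
    exact (measurePreserving_tail fun i => if b i then q else p).lintegral_comp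
      (f := fun z => H (z, Fin.tail b)) (by fun_prop)
  simp only [h]
  rw [← (Fin.consEquiv fun _ => Bool).sum_comp, Fintype.sum_prod_type]
  simp only [Fin.consEquiv, Equiv.coe_fn_mk, Fin.tail_cons, Fintype.sum_bool]
  rw [← two_mul, ← mul_assoc, pow_succ, ENNReal.mul_inv (by simp) (by simp), mul_assoc (_⁻¹),
    ENNReal.inv_mul_cancel (by simp) (by simp), mul_one]

/-- Two families with values in a finite type take every value equally often if the sums of the
powers encoding their values agree. -/
lemma sum_comp_eq_of_sum_pow_eq {ι κ M : Type*} [Fintype ι] [Fintype κ] [AddCommMonoid M] {n B : ℕ}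
    (hB : Fintype.card ι < B) {code : κ → ℕ} (hcode : Function.Injective code)
    (hn : ∀ q, code q < n) {f g : ι → κ} (h : ∑ j, B ^ code (f j) = ∑ j, B ^ code (g j))
    (φ : κ → M) : ∑ j, φ (f j) = ∑ j, φ (g j) := by
  classical
  have hB' : ∀ (f : ι → κ) (q : Fin n), Finset.card {j | code (f j) = q} < B := fun f q =>
    (Finset.card_le_univ _).trans_lt hB
  have hdigits : ∀ f : ι → κ, ∑ j, B ^ code (f j) =
      finFunctionFinEquiv fun q : Fin n => (⟨Finset.card {j | code (f j) = q}, hB' f q⟩ : Fin B) :=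
    fun f => by
      rw [finFunctionFinEquiv_apply,
        ← Finset.sum_fiberwise Finset.univ (fun j => (⟨code (f j), hn _⟩ : Fin n))]
      refine Finset.sum_congr rfl fun q _ => ?_
      rw [Finset.sum_congr rfl (g := fun _ => B ^ (q : ℕ)) fun j hj => by
        simp [← (Finset.mem_filter.1 hj).2]]
      simp [Fin.ext_iff]
  have hcard : ∀ q, Finset.card {j | f j = q} = Finset.card {j | g j = q} := fun q => by
    have h1 := congrFun (finFunctionFinEquiv.injective
      (Fin.ext ((hdigits f).symm.trans (h.trans (hdigits g))))) ⟨code q, hn q⟩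
    simpa [hcode.eq_iff] using h1
  have hsum : ∀ f : ι → κ, ∑ j, φ (f j) = ∑ q, Finset.card {j | f j = q} • φ q := fun f => by
    rw [← Finset.sum_fiberwise Finset.univ f]
    refine Finset.sum_congr rfl fun q _ => ?_
    rw [Finset.sum_congr rfl (g := fun _ => φ q) fun j hj => by simp [(Finset.mem_filter.1 hj).2]]
    simp
  simp only [hsum, hcard]

/-- The outcome of comparing two edge coordinates, in terms of the outcome `p` of comparing their
parameters. -/
def cmpCode (a a' : Bool × Bool) (p : Bool) : Bool :=
  bif a.1 == a'.1 then bif a.2 == a'.2 then a.2 == p else a'.2 else a'.1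

/-- The piece containing the second coordinate of a point whose first coordinate lies in the
piece `a`. -/
def secondPiece (c : Bool) (a : Bool × Bool) : Bool × Bool := (a.1 == c, a.2 ^^ c)

/-- The comparisons of the coordinates of a triple, in terms of those of the parameters. -/
def cmpCodes (j : Fin 3 → Bool × Bool) (p : Bool × Bool × Bool) : Bool × Bool × Bool :=
  (cmpCode (j 0) (j 1) p.1, cmpCode (j 0) (j 2) p.2.1, cmpCode (j 1) (j 2) p.2.2)

/-- The comparisons of both coordinates of a triple of points on the square. -/
def edgePattern (c : Fin 3 → Bool) (p : Bool × Bool × Bool) (j : Fin 3 → Bool × Bool) :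
    (Bool × Bool × Bool) × (Bool × Bool × Bool) :=
  (cmpCodes j p, cmpCodes (fun i => secondPiece (c i) (j i)) p)

/-- The number with the given binary digits. -/
def patternCode (q : (Bool × Bool × Bool) × (Bool × Bool × Bool)) : ℕ :=
  q.1.1.toNat + 2 * q.1.2.1.toNat + 4 * q.1.2.2.toNat +
    8 * (q.2.1.toNat + 2 * q.2.2.1.toNat + 4 * q.2.2.2.toNat)

lemma sum_pow_edgePattern_eq : ∀ p : Bool × Bool × Bool, p ≠ (true, false, true) →
    p ≠ (false, true, false) → ∀ c : Fin 3 → Bool,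
    ∑ s : Bool × (Fin 3 → Bool × Bool),
      256 ^ patternCode (edgePattern (fun i => s.1 ^^ c i) p s.2) =
    ∑ s : Bool × (Fin 3 → Bool × Bool),
      256 ^ patternCode (edgePattern (fun _ => s.1 ^^ false) p s.2) := by
  decide +kernel

/-- Up to complementing the labels, all labelings of the edges produce every pair of comparison
patterns equally often. -/
lemma sum_edgePattern_eq {M : Type*} [AddCommMonoid M] {p : Bool × Bool × Bool}
    (h1 : p ≠ (true, false, true)) (h2 : p ≠ (false, true, false)) (c c' : Fin 3 → Bool)
    (φ : (Bool × Bool × Bool) × (Bool × Bool × Bool) → M) :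
    ∑ j, φ (edgePattern c p j) + ∑ j, φ (edgePattern (fun i => !c i) p j) =
      ∑ j, φ (edgePattern c' p j) + ∑ j, φ (edgePattern (fun i => !c' i) p j) := by
  have h := sum_comp_eq_of_sum_pow_eq (n := 64) (B := 256) (by simp)
    (by decide : Function.Injective patternCode) (by decide)
    ((sum_pow_edgePattern_eq p h1 h2 c).trans (sum_pow_edgePattern_eq p h1 h2 c').symm) φ
  simp only [Fintype.sum_prod_type, Fintype.sum_bool, Bool.true_xor, Bool.false_xor] at h
  rw [add_comm, h, add_comm]

/-- The coordinate at parameter `m` in the piece `a`. -/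
noncomputable def edgeCoord (a : Bool × Bool) (m : ℝ) : ℝ :=
  (if a.1 then 1 / 2 else 0) + if a.2 then (1 + m) / 4 else (1 - m) / 4

/-- The point of the square at parameter `m` in the piece `a` of the edges labeled `c`. -/
noncomputable def edgePoint (c : Bool) (a : Bool × Bool) (m : ℝ) : ℝ × ℝ :=
  (edgeCoord a m, edgeCoord (secondPiece c a) m)

lemma measurable_edgeCoord (a : Bool × Bool) : Measurable (edgeCoord a) := by
  unfold edgeCoord
  split_ifs <;> fun_prop

lemma measurable_edgePoint (c : Bool) (a : Bool × Bool) : Measurable (edgePoint c a) :=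
  (measurable_edgeCoord _).prodMk (measurable_edgeCoord _)

lemma edgeCoord_mem_Icc (a : Bool × Bool) {m : ℝ} (hm : m ∈ Ioo (0 : ℝ) 1) :
    edgeCoord a m ∈ Icc (0 : ℝ) 1 := by
  obtain ⟨h0, h1⟩ := hm
  rcases a with ⟨_ | _, _ | _⟩ <;> simp only [edgeCoord, mem_Icc] <;> constructor <;>
    norm_num <;> linarith

lemma decide_edgeCoord_lt (a a' : Bool × Bool) {m m' : ℝ} (hm : m ∈ Ioo (0 : ℝ) 1)
    (hm' : m' ∈ Ioo (0 : ℝ) 1) (hne : m ≠ m') :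
    decide (edgeCoord a m < edgeCoord a' m') = cmpCode a a' (decide (m < m')) := by
  obtain ⟨h0, h1⟩ := hm
  obtain ⟨h0', h1'⟩ := hm'
  rcases lt_or_gt_of_ne hne with h | h
  · rw [decide_eq_true h]
    rcases a with ⟨_ | _, _ | _⟩ <;> rcases a' with ⟨_ | _, _ | _⟩ <;>
      simp [edgeCoord, cmpCode] <;> linarith
  · rw [decide_eq_false h.le.not_gt]
    rcases a with ⟨_ | _, _ | _⟩ <;> rcases a' with ⟨_ | _, _ | _⟩ <;>
      simp [edgeCoord, cmpCode] <;> linarith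

/-- The comparisons of the first and of the second coordinates of a triple of points. -/
noncomputable def pointPattern (z : Fin 3 → ℝ × ℝ) :
    (Bool × Bool × Bool) × (Bool × Bool × Bool) :=
  (cmpBits fun i => (z i).1, cmpBits fun i => (z i).2)

lemma cmpBits_edgeCoord (j : Fin 3 → Bool × Bool) {m : Fin 3 → ℝ}
    (hm : ∀ i, m i ∈ Ioo (0 : ℝ) 1) (hne : Function.Injective m) :
    cmpBits (fun i => edgeCoord (j i) (m i)) = cmpCodes j (cmpBits m) := by
  simp only [cmpBits, cmpCodes]
  rw [decide_edgeCoord_lt _ _ (hm 0) (hm 1) (hne.ne (by decide)),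
    decide_edgeCoord_lt _ _ (hm 0) (hm 2) (hne.ne (by decide)),
    decide_edgeCoord_lt _ _ (hm 1) (hm 2) (hne.ne (by decide))]

lemma pointPattern_edgePoint (c : Fin 3 → Bool) (j : Fin 3 → Bool × Bool) {m : Fin 3 → ℝ}
    (hm : ∀ i, m i ∈ Ioo (0 : ℝ) 1) (hne : Function.Injective m) :
    pointPattern (fun i => edgePoint (c i) (j i) (m i)) = edgePattern c (cmpBits m) j := by
  simp only [pointPattern, edgePoint, edgePattern]
  rw [cmpBits_edgeCoord j hm hne, cmpBits_edgeCoord (fun i => secondPiece (c i) (j i)) hm hne]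

lemma cmpBits_ne_of_injective {m : Fin 3 → ℝ} (hne : Function.Injective m) :
    cmpBits m ≠ (true, false, true) ∧ cmpBits m ≠ (false, true, false) := by
  have h02 : m 0 ≠ m 2 := hne.ne (by decide)
  simp only [cmpBits, ne_eq, Prod.mk.injEq, decide_eq_true_eq, decide_eq_false_iff_not, not_and,
    not_lt]
  grind

/-- The uniform distribution on the open unit interval. -/
noncomputable def unitMeasure : Measure ℝ := volume.restrict (Ioo 0 1)

instance : IsProbabilityMeasure unitMeasure := ⟨by simp [unitMeasure]⟩

instance : NullSingletonClass unitMeasure := by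
  unfold unitMeasure
  infer_instance

lemma map_affine_unitMeasure {α β : ℝ} (hα : α ≠ 0) {s : Set ℝ} (hs : MeasurableSet s)
    (h : (fun m => α * m + β) ⁻¹' s = Ioo 0 1) :
    unitMeasure.map (fun m => α * m + β) = ENNReal.ofReal |α⁻¹| • volume.restrict s := by
  have hf : Measurable fun m : ℝ => α * m + β := by fun_prop
  rw [unitMeasure, ← h, ← Measure.restrict_map hf hs]
  have : (volume : Measure ℝ).map (fun m => α * m + β) = ENNReal.ofReal |α⁻¹| • volume := by
    rw [show (fun m : ℝ => α * m + β) = (fun m => m + β) ∘ (fun m => α * m) from rfl,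
      ← Measure.map_map (by fun_prop) (by fun_prop), Real.map_volume_mul_left hα,
      Measure.map_smul, map_add_right_eq_self]
  rw [this, Measure.restrict_smul]

lemma map_edgeCoord_unitMeasure (a : Bool × Bool) :
    unitMeasure.map (edgeCoord a) = (4 : ℝ≥0∞) • volume.restrict
      (Ioc ((if a.1 then 1 / 2 else 0) + if a.2 then 1 / 4 else 0)
        ((if a.1 then 1 / 2 else 0) + if a.2 then 1 / 2 else 1 / 4)) := by
  have key : ∀ α β x y : ℝ, |α⁻¹| = 4 → edgeCoord a = (fun m => α * m + β) →
      ((fun m => α * m + β) ⁻¹' Ioo x y = Ioo 0 1) →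
      unitMeasure.map (edgeCoord a) = (4 : ℝ≥0∞) • volume.restrict (Ioc x y) := by
    intro α β x y hα he hp
    have h0 : α ≠ 0 := by rintro rfl; norm_num at hα
    rw [he, map_affine_unitMeasure h0 measurableSet_Ioo hp, hα,
      Measure.restrict_congr_set Ioo_ae_eq_Ioc]
    norm_num
  rcases a with ⟨h, _ | _⟩
  · refine key (-1 / 4) ((if h then 1 / 2 else 0) + 1 / 4) _ _ (by norm_num) ?_ ?_
    · ext m; simp only [edgeCoord, Bool.false_eq_true, if_false]; ring
    · ext m
      simp only [Bool.false_eq_true, if_false, mem_preimage, mem_Ioo]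
      constructor <;> rintro ⟨h1, h2⟩ <;> constructor <;> linarith
  · refine key (1 / 4) ((if h then 1 / 2 else 0) + 1 / 4) _ _ (by norm_num) ?_ ?_
    · ext m; simp only [edgeCoord, if_true]; ring
    · ext m
      simp only [if_true, mem_preimage, mem_Ioo]
      constructor <;> rintro ⟨h1, h2⟩ <;> constructor <;> linarith

lemma restrict_Icc_eq_sum_map_edgeCoord :
    (volume : Measure ℝ).restrict (Icc 0 1) =
      (4 : ℝ≥0∞)⁻¹ • ∑ a, unitMeasure.map (edgeCoord a) := by
  have h4 : (4 : ℝ≥0∞)⁻¹ * 4 = 1 := ENNReal.inv_mul_cancel (by simp) (by simp)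
  have hu : ∀ x y z : ℝ, x ≤ y → y ≤ z → (volume : Measure ℝ).restrict (Ioc x z) =
      volume.restrict (Ioc x y) + volume.restrict (Ioc y z) := fun x y z h h' => by
    rw [← Measure.restrict_union (Ioc_disjoint_Ioc_of_le le_rfl) measurableSet_Ioc,
      Ioc_union_Ioc_eq_Ioc h h']
  simp only [map_edgeCoord_unitMeasure, ← Finset.smul_sum, smul_smul, h4, one_smul]
  rw [← Measure.restrict_congr_set Ioc_ae_eq_Icc, hu 0 (1 / 2) 1 (by norm_num) (by norm_num),
    hu 0 (1 / 4) (1 / 2) (by norm_num) (by norm_num),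
    hu (1 / 2) (3 / 4) 1 (by norm_num) (by norm_num)]
  simp only [Fintype.sum_prod_type, Fintype.sum_bool, Bool.false_eq_true, if_true, if_false]
  norm_num
  abel

lemma edgeDist_eq_sum (c : Bool) :
    edgeDist c = (4 : ℝ≥0∞)⁻¹ • ∑ a, unitMeasure.map (edgePoint c a) := by
  have key : ∀ g : ℝ → ℝ × ℝ, Measurable g →
      (∀ a, ∀ m ∈ Ioo (0 : ℝ) 1, g (edgeCoord a m) = edgePoint c a m) →
      (volume.restrict (Icc (0 : ℝ) 1)).map g =
        (4 : ℝ≥0∞)⁻¹ • ∑ a, unitMeasure.map (edgePoint c a) := by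
    intro g hg h
    rw [restrict_Icc_eq_sum_map_edgeCoord, Measure.map_smul,
      ← Measure.mapₗ_apply_of_measurable hg, map_sum]
    congr 1
    refine Finset.sum_congr rfl fun a _ => ?_
    rw [Measure.mapₗ_apply_of_measurable hg, Measure.map_map hg (measurable_edgeCoord a)]
    exact Measure.map_congr ((ae_restrict_iff' measurableSet_Ioo).2 (.of_forall (h a)))
  have hle : ∀ e, ∀ m ∈ Ioo (0 : ℝ) 1, edgeCoord (false, e) m ≤ 1 / 2 := by
    rintro (_ | _) m ⟨h0, h1⟩ <;> simp [edgeCoord] <;> linarith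
  have hgt : ∀ e, ∀ m ∈ Ioo (0 : ℝ) 1, ¬edgeCoord (true, e) m ≤ 1 / 2 := by
    rintro (_ | _) m ⟨h0, h1⟩ <;> simp [edgeCoord] <;> linarith
  cases c
  · refine key _ (Measurable.ite measurableSet_Iic (by fun_prop) (by fun_prop)) ?_
    rintro ⟨_ | _, e⟩ m hm
    · rw [if_pos (hle e m hm)]
      cases e <;> simp [edgeCoord, edgePoint, secondPiece]
    · rw [if_neg (hgt e m hm)]
      cases e <;> simp [edgeCoord, edgePoint, secondPiece]
  · refine key _ (Measurable.ite measurableSet_Iic (by fun_prop) (by fun_prop)) ?_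
    rintro ⟨_ | _, e⟩ m hm
    · rw [if_pos (hle e m hm)]
      cases e <;> simp [edgeCoord, edgePoint, secondPiece] <;> ring
    · rw [if_neg (hgt e m hm)]
      cases e <;> simp [edgeCoord, edgePoint, secondPiece] <;> ring

lemma lintegral_edgeDist (c : Bool) {f : ℝ × ℝ → ℝ≥0∞} (hf : Measurable f) :
    ∫⁻ z, f z ∂edgeDist c = (4 : ℝ≥0∞)⁻¹ * ∑ a, ∫⁻ m, f (edgePoint c a m) ∂unitMeasure := by
  rw [edgeDist_eq_sum, lintegral_smul_measure, lintegral_finsetSum_measure, smul_eq_mul]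
  simp only [lintegral_map hf (measurable_edgePoint c _)]

lemma lintegral_pi_edgeDist {n : ℕ} (c : Fin n → Bool) {f : (Fin n → ℝ × ℝ) → ℝ≥0∞}
    (hf : Measurable f) :
    ∫⁻ z, f z ∂Measure.pi (fun i => edgeDist (c i)) = (4 : ℝ≥0∞)⁻¹ ^ n *
      ∫⁻ m, ∑ j : Fin n → Bool × Bool, f (fun i => edgePoint (c i) (j i) (m i))
        ∂Measure.pi fun _ => unitMeasure := by
  have hpt : ∀ j : Fin n → Bool × Bool,
      Measurable fun (m : Fin n → ℝ) i => edgePoint (c i) (j i) (m i) := fun j =>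
    measurable_pi_iff.2 fun i => (measurable_edgePoint _ _).comp (measurable_pi_apply i)
  have : ∀ i a, IsProbabilityMeasure (unitMeasure.map (edgePoint (c i) a)) := fun i a =>
    Measure.isProbabilityMeasure_map (measurable_edgePoint _ _).aemeasurable
  simp only [edgeDist_eq_sum]
  rw [pi_smul_sum (by simp) fun i a => unitMeasure.map (edgePoint (c i) a),
    lintegral_smul_measure, lintegral_finsetSum_measure, smul_eq_mul, Fintype.card_fin,
    lintegral_finsetSum (f := fun j (m : Fin n → ℝ) => f fun i => edgePoint (c i) (j i) (m i)) _
      fun j _ => hf.comp (hpt j)]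
  congr 1
  refine Finset.sum_congr rfl fun j _ => ?_
  rw [← Measure.pi_map_pi fun i => (measurable_edgePoint _ _).aemeasurable,
    lintegral_map hf (hpt j)]

lemma lintegral_pi_pair_le {X : Type*} [MeasurableSpace X] {n : ℕ} (μ : Fin n → Measure X)
    [∀ i, IsProbabilityMeasure (μ i)] {i j : Fin n} (hij : i ≠ j) {f : X × X → ℝ≥0∞}
    (hf : Measurable f) {K : ℝ≥0∞} (hK : ∀ y, ∫⁻ x, f (x, y) ∂μ i ≤ K) :
    ∫⁻ z, f (z i, z j) ∂Measure.pi μ ≤ K := by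
  have hind := (ProbabilityTheory.iIndepFun_pi (μ := μ) (X := fun _ x => x)
    fun _ => aemeasurable_id).indepFun hij
  rw [ProbabilityTheory.indepFun_iff_map_prod_eq_prod_map_map
      (measurable_pi_apply i).aemeasurable (measurable_pi_apply j).aemeasurable,
    (measurePreserving_eval μ i).map_eq, (measurePreserving_eval μ j).map_eq] at hind
  rw [← lintegral_map (f := f) (g := fun z : Fin n → X => (z i, z j)) hf (by fun_prop), hind,
    lintegral_prod_symm _ hf.aemeasurable]
  exact (lintegral_mono hK).trans (by simp)

lemma ae_pi_unitMeasure_injective {n : ℕ} :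
    ∀ᵐ m ∂Measure.pi fun _ : Fin n => unitMeasure, Function.Injective m := by
  have hne : ∀ i j : Fin n, i ≠ j → ∀ᵐ m ∂Measure.pi fun _ : Fin n => unitMeasure, m i ≠ m j := by
    intro i j hij
    set f : ℝ × ℝ → ℝ≥0∞ := {p | p.1 = p.2}.indicator 1 with hf
    have hfm : Measurable f :=
      measurable_one.indicator (measurableSet_eq_fun measurable_fst measurable_snd)
    have h := lintegral_pi_pair_le (fun _ : Fin n => unitMeasure) hij hfm (K := 0) fun y => by
      rw [nonpos_iff_eq_zero, lintegral_eq_zero_iff (by fun_prop)]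
      filter_upwards [Measure.ae_ne unitMeasure y] with x hx
      simp [hf, hx]
    rw [nonpos_iff_eq_zero, lintegral_eq_zero_iff (by fun_prop)] at h
    filter_upwards [h] with m hm
    simpa [hf] using hm
  simp only [Function.Injective, ae_all_iff]
  intro i j
  by_cases hij : i = j
  · exact .of_forall fun _ _ => hij
  · filter_upwards [hne i j hij] with m hm h using absurd h hm

lemma ae_pi_unitMeasure_mem {n : ℕ} :
    ∀ᵐ m ∂Measure.pi fun _ : Fin n => unitMeasure, ∀ i, m i ∈ Ioo (0 : ℝ) 1 := by
  refine ae_all_iff.2 fun i => ?_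
  exact (measurePreserving_eval (fun _ : Fin n => unitMeasure) i).quasiMeasurePreserving.ae
    (ae_restrict_mem measurableSet_Ioo)

lemma measurable_cmpBits : Measurable (cmpBits : (Fin 3 → ℝ) → Bool × Bool × Bool) := by
  have h : ∀ i j : Fin 3, Measurable fun x : Fin 3 → ℝ => decide (x i < x j) := fun i j =>
    measurable_to_bool (by
      have : (fun x : Fin 3 → ℝ => decide (x i < x j)) ⁻¹' {true} = {x | x i < x j} := by
        ext x; simp
      rw [this]
      exact measurableSet_lt (by fun_prop) (by fun_prop))
  exact (h 0 1).prodMk ((h 0 2).prodMk (h 1 2))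

lemma measurable_pointPattern : Measurable pointPattern :=
  (measurable_cmpBits.comp (by fun_prop)).prodMk (measurable_cmpBits.comp (by fun_prop))

/-- Functions of the comparison patterns of three points do not distinguish complementary pairs
of labelings of the edges from one another. -/
lemma lintegral_pointPattern_add_compl (c c' : Fin 3 → Bool)
    (φ : (Bool × Bool × Bool) × (Bool × Bool × Bool) → ℝ≥0∞) :
    ∫⁻ z, φ (pointPattern z) ∂Measure.pi (fun i => edgeDist (c i)) +
        ∫⁻ z, φ (pointPattern z) ∂Measure.pi (fun i => edgeDist (!c i)) =
      ∫⁻ z, φ (pointPattern z) ∂Measure.pi (fun i => edgeDist (c' i)) +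
        ∫⁻ z, φ (pointPattern z) ∂Measure.pi (fun i => edgeDist (!c' i)) := by
  have hφ : Measurable fun z => φ (pointPattern z) :=
    (Measurable.of_discrete (f := φ)).comp measurable_pointPattern
  have hedge : ∀ c : Fin 3 → Bool,
      ∫⁻ z, φ (pointPattern z) ∂Measure.pi (fun i => edgeDist (c i)) = (4 : ℝ≥0∞)⁻¹ ^ 3 *
        ∫⁻ m, ∑ j, φ (edgePattern c (cmpBits m) j) ∂Measure.pi fun _ => unitMeasure := fun c => by
    rw [lintegral_pi_edgeDist c hφ]
    congr 1
    refine lintegral_congr_ae ?_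
    filter_upwards [ae_pi_unitMeasure_mem, ae_pi_unitMeasure_injective] with m hm hne
    simp only [pointPattern_edgePoint c _ hm hne]
  have hmeas : ∀ c : Fin 3 → Bool,
      Measurable fun m : Fin 3 → ℝ => ∑ j, φ (edgePattern c (cmpBits m) j) := fun c =>
    (Measurable.of_discrete (f := fun p => ∑ j, φ (edgePattern c p j))).comp measurable_cmpBits
  rw [hedge c, hedge c', hedge fun i => !c i, hedge fun i => !c' i, ← mul_add, ← mul_add,
    ← lintegral_add_left (hmeas c), ← lintegral_add_left (hmeas c')]
  congr 1
  refine lintegral_congr_ae ?_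
  filter_upwards [ae_pi_unitMeasure_injective] with m hne
  obtain ⟨h1, h2⟩ := cmpBits_ne_of_injective hne
  exact sum_edgePattern_eq h1 h2 c c' φ

lemma lintegral_negLog_lt_top : ∫⁻ d, negLog d < ⊤ := by
  have hint : IntegrableOn Real.log (Ioc (-1) 1) :=
    (intervalIntegrable_iff_integrableOn_Ioc_of_le (by norm_num)).1
      intervalIntegral.intervalIntegrable_log'
  refine lt_of_le_of_lt ?_ hint.neg.lintegral_lt_top
  rw [← lintegral_indicator measurableSet_Ioc]
  refine lintegral_mono_ae ?_
  filter_upwards [Measure.ae_ne volume (0 : ℝ)] with d hd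
  by_cases h : d ∈ Ioc (-1 : ℝ) 1
  · simp [negLog, hd, h]
  · have habs : 1 ≤ |d| := by
      by_contra! hlt
      exact h ⟨(abs_lt.1 hlt).1, (abs_lt.1 hlt).2.le⟩
    have : 0 ≤ Real.log d := by
      rw [← Real.log_abs]
      exact Real.log_nonneg habs
    simp [negLog, hd, h, this]

lemma lintegral_negLog_edgeCoord_le (a : Bool × Bool) (y : ℝ) :
    ∫⁻ m, negLog (edgeCoord a m - y) ∂unitMeasure ≤ 4 * ∫⁻ d, negLog d := by
  have hm : Measurable fun x => negLog (x - y) := measurable_negLog.comp (by fun_prop)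
  rw [← lintegral_map (f := fun x => negLog (x - y)) hm (measurable_edgeCoord a),
    map_edgeCoord_unitMeasure, lintegral_smul_measure, smul_eq_mul]
  exact mul_le_mul_right ((lintegral_mono' Measure.restrict_le_self le_rfl).trans
    (lintegral_sub_right_eq_self (μ := volume) negLog y).le) _

lemma lintegral_negLog_edgeDist_le (c : Bool) (y : ℝ) :
    ∫⁻ z, negLog (z.1 - y) ∂edgeDist c ≤ 4 * ∫⁻ d, negLog d ∧
      ∫⁻ z, negLog (z.2 - y) ∂edgeDist c ≤ 4 * ∫⁻ d, negLog d := by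
  have h1 : Measurable fun z : ℝ × ℝ => negLog (z.1 - y) := measurable_negLog.comp (by fun_prop)
  have h2 : Measurable fun z : ℝ × ℝ => negLog (z.2 - y) := measurable_negLog.comp (by fun_prop)
  have hsum : ∀ F : Bool × Bool → ℝ≥0∞, (∀ a, F a ≤ 4 * ∫⁻ d, negLog d) →
      (4 : ℝ≥0∞)⁻¹ * ∑ a, F a ≤ 4 * ∫⁻ d, negLog d := fun F hF => by
    calc (4 : ℝ≥0∞)⁻¹ * ∑ a, F a ≤ (4 : ℝ≥0∞)⁻¹ * ∑ _a : Bool × Bool, 4 * ∫⁻ d, negLog d := by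
          gcongr with a; exact hF a
      _ = ((4 : ℝ≥0∞)⁻¹ * 4) * (4 * ∫⁻ d, negLog d) := by
          simp [mul_assoc]
      _ = _ := by rw [ENNReal.inv_mul_cancel (by simp) (by simp), one_mul]
  rw [lintegral_edgeDist c h1, lintegral_edgeDist c h2]
  exact ⟨hsum _ fun a => lintegral_negLog_edgeCoord_le _ _,
    hsum _ fun a => lintegral_negLog_edgeCoord_le _ _⟩

/-- The total penalty of a triple of points. -/
noncomputable def pointPenalty (z : Fin 3 → ℝ × ℝ) : ℝ≥0∞ :=
  gapPenalty (fun i => (z i).1) + gapPenalty fun i => (z i).2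

lemma measurable_pointPenalty : Measurable pointPenalty :=
  (measurable_gapPenalty.comp (by fun_prop)).add (measurable_gapPenalty.comp (by fun_prop))

lemma lintegral_pointPenalty_pi_le (c : Fin 3 → Bool) :
    ∫⁻ z, pointPenalty z ∂Measure.pi (fun i => edgeDist (c i)) ≤ 24 * ∫⁻ d, negLog d := by
  have hn := measurable_negLog
  have h1 : ∀ i j : Fin 3, i ≠ j → ∫⁻ z, negLog ((z i).1 - (z j).1)
      ∂Measure.pi (fun i => edgeDist (c i)) ≤ 4 * ∫⁻ d, negLog d := fun i j hij =>
    lintegral_pi_pair_le (fun i => edgeDist (c i)) hij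
      (f := fun p : (ℝ × ℝ) × (ℝ × ℝ) => negLog (p.1.1 - p.2.1)) (by fun_prop)
      fun y => (lintegral_negLog_edgeDist_le (c i) y.1).1
  have h2 : ∀ i j : Fin 3, i ≠ j → ∫⁻ z, negLog ((z i).2 - (z j).2)
      ∂Measure.pi (fun i => edgeDist (c i)) ≤ 4 * ∫⁻ d, negLog d := fun i j hij =>
    lintegral_pi_pair_le (fun i => edgeDist (c i)) hij
      (f := fun p : (ℝ × ℝ) × (ℝ × ℝ) => negLog (p.1.2 - p.2.2)) (by fun_prop)
      fun y => (lintegral_negLog_edgeDist_le (c i) y.2).2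
  simp only [pointPenalty, gapPenalty]
  rw [lintegral_add_left (by fun_prop), lintegral_add_left (by fun_prop),
    lintegral_add_left (by fun_prop), lintegral_add_left (by fun_prop),
    lintegral_add_left (by fun_prop)]
  refine (add_le_add (add_le_add (add_le_add (h1 0 1 (by decide)) (h1 0 2 (by decide)))
    (h1 1 2 (by decide))) (add_le_add (add_le_add (h2 0 1 (by decide)) (h2 0 2 (by decide)))
    (h2 1 2 (by decide)))).trans (le_of_eq ?_)
  ring

lemma lintegral_labeledSamples_edge_le {m : ℕ} {f : (Fin m → ℝ × ℝ) → ℝ≥0∞} (hf : Measurable f)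
    {K : ℝ≥0∞} (hK : ∀ c : Fin m → Bool, ∫⁻ z, f z ∂Measure.pi (fun i => edgeDist (c i)) ≤ K) :
    ∫⁻ z, f z.1 ∂labeledSamples m squareDist squareDist ≤ K ∧ ∫⁻ z, f z.1 ∂mixedSamples m ≤ K := by
  have hf' : Measurable fun z : (Fin m → ℝ × ℝ) × (Fin m → Bool) => f z.1 := by fun_prop
  have havg : ∀ F : (Fin m → Bool) → ℝ≥0∞, (∀ b, F b ≤ K) →
      ((2 : ℝ≥0∞) ^ m)⁻¹ * ∑ b, F b ≤ K := fun F hF => by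
    calc ((2 : ℝ≥0∞) ^ m)⁻¹ * ∑ b, F b ≤ ((2 : ℝ≥0∞) ^ m)⁻¹ * ∑ _b : Fin m → Bool, K := by
          gcongr with b; exact hF b
      _ = (((2 : ℝ≥0∞) ^ m)⁻¹ * 2 ^ m) * K := by simp [mul_assoc]
      _ = K := by rw [ENNReal.inv_mul_cancel (by simp) (by simp), one_mul]
  rw [lintegral_labeledSamples_square hf', lintegral_mixedSamples hf']
  refine ⟨havg _ fun b => havg _ hK, havg _ fun b => ?_⟩
  calc _ ≤ (2 : ℝ≥0∞)⁻¹ * (K + K) := by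
        gcongr
        · exact hK b
        · exact hK fun i => !b i
    _ = ((2 : ℝ≥0∞)⁻¹ * 2) * K := by ring
    _ = K := by rw [ENNReal.inv_mul_cancel (by simp) (by simp), one_mul]

lemma tvDist_self {X : Type*} [MeasurableSpace X] (μ : Measure X) : tvDist μ μ = 0 := by
  simp [tvDist]

lemma tvDist_le {X : Type*} [MeasurableSpace X] {μ ν : Measure X} [IsFiniteMeasure μ]
    [IsFiniteMeasure ν] {δ : ℝ≥0∞} (hδ : δ ≠ ⊤)
    (h : ∀ A, MeasurableSet A → μ A ≤ ν A + δ ∧ ν A ≤ μ A + δ) : tvDist μ ν ≤ δ.toReal := by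
  have : Nonempty {A : Set X // MeasurableSet A} := ⟨⟨∅, .empty⟩⟩
  refine ciSup_le fun ⟨A, hA⟩ => ?_
  obtain ⟨h1, h2⟩ := h A hA
  have h1' := ENNReal.toReal_mono (by finiteness) h1
  have h2' := ENNReal.toReal_mono (by finiteness) h2
  rw [ENNReal.toReal_add (by finiteness) hδ] at h1' h2'
  rw [abs_le]
  constructor <;> linarith

lemma measurable_transform (m : ℕ) :
    Measurable fun ω : ((ℝ × ℝ × ℝ) × (ℝ × ℝ × ℝ)) × ((Fin m → ℝ × ℝ) × (Fin m → Bool)) =>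
      ((fun i => (applyMW ω.1.1 (ω.2.1 i).1, applyMW ω.1.2 (ω.2.1 i).2), ω.2.2) :
        (Fin m → ℝ × ℝ) × (Fin m → Bool)) := by
  have h := measurable_applyMW
  refine Measurable.prodMk (measurable_pi_iff.2 fun i => ?_) (by fun_prop)
  exact (h.comp (f := fun ω : ((ℝ × ℝ × ℝ) × (ℝ × ℝ × ℝ)) × ((Fin m → ℝ × ℝ) × (Fin m → Bool)) =>
      (ω.1.1, (ω.2.1 i).1)) (by fun_prop)).prodMk
    (h.comp (f := fun ω : ((ℝ × ℝ × ℝ) × (ℝ × ℝ × ℝ)) × ((Fin m → ℝ × ℝ) × (Fin m → Bool)) =>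
      (ω.1.2, (ω.2.1 i).2)) (by fun_prop))

lemma isProbabilityMeasure_transformedLaw {W : ℝ} (hW : Real.exp (Real.exp (Real.exp 1)) ≤ W)
    {m : ℕ} (μ : Measure ((Fin m → ℝ × ℝ) × (Fin m → Bool))) [IsProbabilityMeasure μ] :
    IsProbabilityMeasure (transformedLaw W m μ) := by
  have := isProbabilityMeasure_mwParams hW
  exact Measure.isProbabilityMeasure_map (measurable_transform m).aemeasurable

lemma transformedLaw_map_dropFirst {W : ℝ} (hW : Real.exp (Real.exp (Real.exp 1)) ≤ W) {m : ℕ}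
    (μ : Measure ((Fin (m + 1) → ℝ × ℝ) × (Fin (m + 1) → Bool))) [IsProbabilityMeasure μ] :
    transformedLaw W m (μ.map dropFirst) = (transformedLaw W (m + 1) μ).map dropFirst := by
  have := isProbabilityMeasure_mwParams hW
  have hprod := Measure.map_prod_map ((mwParams W).prod (mwParams W)) μ measurable_id
    (measurable_dropFirst (m := m))
  rw [Measure.map_id] at hprod
  rw [transformedLaw, transformedLaw, hprod,
    Measure.map_map (measurable_transform m) (measurable_id.prodMap measurable_dropFirst),
    Measure.map_map measurable_dropFirst (measurable_transform (m + 1))]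
  rfl

lemma map_dropFirst_mixedSamples (m : ℕ) :
    (mixedSamples (m + 1)).map dropFirst = mixedSamples m := by
  rw [mixedSamples, Measure.map_smul, Measure.map_add _ _ measurable_dropFirst,
    map_dropFirst_labeledSamples, map_dropFirst_labeledSamples, mixedSamples]

lemma transformedLaw_apply {W : ℝ} (hW : Real.exp (Real.exp (Real.exp 1)) ≤ W) {m : ℕ}
    (μ : Measure ((Fin m → ℝ × ℝ) × (Fin m → Bool))) [IsProbabilityMeasure μ]
    {A : Set ((Fin m → ℝ × ℝ) × (Fin m → Bool))} (hA : MeasurableSet A) :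
    transformedLaw W m μ A = ∫⁻ z, ∫⁻ ω, A.indicator 1
      ((fun i => (applyMW ω.1 (z.1 i).1, applyMW ω.2 (z.1 i).2)), z.2)
        ∂(mwParams W).prod (mwParams W) ∂μ := by
  have := isProbabilityMeasure_mwParams hW
  have hind : Measurable (A.indicator (1 : (Fin m → ℝ × ℝ) × (Fin m → Bool) → ℝ≥0∞)) :=
    measurable_one.indicator hA
  rw [← lintegral_indicator_one hA, transformedLaw, lintegral_map hind (measurable_transform m)]
  exact lintegral_prod_symm _ (hind.comp (measurable_transform m)).aemeasurable

/-- The probability that the reference transformation of a triple with given comparison patterns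
lies in a set. -/
noncomputable def refProb (W : ℝ) (A : Set ((Fin 3 → ℝ × ℝ) × (Fin 3 → Bool))) (b : Fin 3 → Bool)
    (q : (Bool × Bool × Bool) × (Bool × Bool × Bool)) : ℝ≥0∞ :=
  ∫⁻ ω, A.indicator 1 ((fun i => (refVec ω.1 (rankOf q.1 i), refVec ω.2 (rankOf q.2 i))), b)
    ∂(mwParams W).prod (mwParams W)

lemma measurable_comp_pointPattern
    (φ : (Fin 3 → Bool) → (Bool × Bool × Bool) × (Bool × Bool × Bool) → ℝ≥0∞) :
    Measurable fun z : (Fin 3 → ℝ × ℝ) × (Fin 3 → Bool) => φ z.2 (pointPattern z.1) :=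
  measurable_from_prod_countable_left fun b =>
    (Measurable.of_discrete (f := φ b)).comp measurable_pointPattern

lemma lintegral_refProb_eq (W : ℝ) (A : Set ((Fin 3 → ℝ × ℝ) × (Fin 3 → Bool))) :
    ∫⁻ z, refProb W A z.2 (pointPattern z.1) ∂labeledSamples 3 squareDist squareDist =
      ∫⁻ z, refProb W A z.2 (pointPattern z.1) ∂mixedSamples 3 :=
  lintegral_labeledSamples_square_eq_mixedSamples (measurable_comp_pointPattern (refProb W A))
    fun b c c' => lintegral_pointPattern_add_compl c c' (refProb W A b)

/-- The pointwise error of the reference transformation. -/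
noncomputable def refError (W : ℝ) (z : Fin 3 → ℝ × ℝ) : ℝ≥0∞ :=
  ENNReal.ofReal (4 / Real.log (Real.log W)) * (2 + pointPenalty z)

lemma measurable_refError (W : ℝ) : Measurable (refError W) :=
  (measurable_pointPenalty.const_add 2).const_mul _

lemma refProb_close {W : ℝ} (hW : Real.exp (Real.exp (Real.exp 1)) ≤ W)
    {A : Set ((Fin 3 → ℝ × ℝ) × (Fin 3 → Bool))} (hA : MeasurableSet A) (b : Fin 3 → Bool)
    {z : Fin 3 → ℝ × ℝ} (hz : ∀ i, (z i).1 ∈ Icc (0 : ℝ) 1 ∧ (z i).2 ∈ Icc (0 : ℝ) 1) :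
    refProb W A b (pointPattern z) ≤ ∫⁻ ω, A.indicator 1
        ((fun i => (applyMW ω.1 (z i).1, applyMW ω.2 (z i).2)), b)
          ∂(mwParams W).prod (mwParams W) + refError W z ∧
      ∫⁻ ω, A.indicator 1 ((fun i => (applyMW ω.1 (z i).1, applyMW ω.2 (z i).2)), b)
          ∂(mwParams W).prod (mwParams W) ≤ refProb W A b (pointPattern z) + refError W z := by
  have := isProbabilityMeasure_mwParams hW
  have hind : Measurable (A.indicator (1 : (Fin 3 → ℝ × ℝ) × (Fin 3 → Bool) → ℝ≥0∞)) :=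
    measurable_one.indicator hA
  have hG : Measurable fun v : (Fin 3 → ℝ) × (Fin 3 → ℝ) =>
      A.indicator (1 : (Fin 3 → ℝ × ℝ) × (Fin 3 → Bool) → ℝ≥0∞) ((fun i => (v.1 i, v.2 i)), b) :=
    hind.comp (by fun_prop)
  have hG1 : ∀ v : (Fin 3 → ℝ) × (Fin 3 → ℝ),
      A.indicator (1 : (Fin 3 → ℝ × ℝ) × (Fin 3 → Bool) → ℝ≥0∞)
        ((fun i => (v.1 i, v.2 i)), b) ≤ 1 := fun v =>
    indicator_le_self' (fun _ _ => zero_le) _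
  have href : ∀ r : Fin 3 → Fin 3, Measurable fun l a => refVec l (r a) := fun r =>
    measurable_pi_iff.2 fun a => (measurable_pi_apply (r a)).comp measurable_refVec
  have happ : ∀ x : Fin 3 → ℝ, Measurable fun l a => applyMW l (x a) := fun x =>
    measurable_pi_iff.2 fun a =>
      measurable_applyMW.comp (f := fun l => (l, x a)) (by fun_prop)
  have h := (testLe_refVec hW fun i => (hz i).1).prod (href _) (happ _) (href _) (happ _)
    (testLe_refVec hW fun i => (hz i).2)
  have hε : ENNReal.ofReal (4 / Real.log (Real.log W)) * (1 + gapPenalty fun i => (z i).1) +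
      ENNReal.ofReal (4 / Real.log (Real.log W)) * (1 + gapPenalty fun i => (z i).2) =
      refError W z := by
    rw [refError, pointPenalty]
    ring
  rw [hε] at h
  have h' := h.symm (((href _).comp measurable_fst).prodMk ((href _).comp measurable_snd))
    (((happ _).comp measurable_fst).prodMk ((happ _).comp measurable_snd))
  exact ⟨h _ hG hG1, h' _ hG hG1⟩

lemma ae_mem_Icc_samples :
    (∀ᵐ z ∂labeledSamples 3 squareDist squareDist, ∀ i,
      (z.1 i).1 ∈ Icc (0 : ℝ) 1 ∧ (z.1 i).2 ∈ Icc (0 : ℝ) 1) ∧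
    (∀ᵐ z ∂mixedSamples 3, ∀ i, (z.1 i).1 ∈ Icc (0 : ℝ) 1 ∧ (z.1 i).2 ∈ Icc (0 : ℝ) 1) := by
  set S : Set (Fin 3 → ℝ × ℝ) := {z | ∀ i, (z i).1 ∈ Icc (0 : ℝ) 1 ∧ (z i).2 ∈ Icc (0 : ℝ) 1}
    with hS
  have hSm : MeasurableSet S := by
    have : S = ⋂ i, (fun z : Fin 3 → ℝ × ℝ => z i) ⁻¹' (Icc 0 1 ×ˢ Icc 0 1) := by
      ext z
      simp only [hS, mem_ofPred_eq, mem_iInter, mem_preimage, mem_prod]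
    rw [this]
    exact .iInter fun i => measurable_pi_apply i (measurableSet_Icc.prod measurableSet_Icc)
  have hf : Measurable (Sᶜ.indicator (1 : (Fin 3 → ℝ × ℝ) → ℝ≥0∞)) :=
    measurable_one.indicator hSm.compl
  obtain ⟨h1, h2⟩ := lintegral_labeledSamples_edge_le hf (K := 0) fun c => by
    rw [lintegral_pi_edgeDist c hf, nonpos_iff_eq_zero]
    refine mul_eq_zero_of_right _ ?_
    rw [lintegral_congr_ae (g := fun _ => 0), lintegral_zero]
    filter_upwards [ae_pi_unitMeasure_mem] with m hm
    refine Finset.sum_eq_zero fun j _ => indicator_of_notMem (notMem_compl_iff.2 fun i => ?_) _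
    exact ⟨edgeCoord_mem_Icc _ (hm i), edgeCoord_mem_Icc _ (hm i)⟩
  rw [nonpos_iff_eq_zero, lintegral_eq_zero_iff (by fun_prop)] at h1 h2
  constructor
  · filter_upwards [h1] with z hz
    by_contra hn
    simp [show z.1 ∈ Sᶜ from hn] at hz
  · filter_upwards [h2] with z hz
    by_contra hn
    simp [show z.1 ∈ Sᶜ from hn] at hz

lemma lintegral_refError_le {W : ℝ} (μ : Measure ((Fin 3 → ℝ × ℝ) × (Fin 3 → Bool)))
    [IsProbabilityMeasure μ] (h : ∫⁻ z, pointPenalty z.1 ∂μ ≤ 24 * ∫⁻ d, negLog d) :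
    ∫⁻ z, refError W z.1 ∂μ ≤
      ENNReal.ofReal (4 / Real.log (Real.log W)) * (2 + 24 * ∫⁻ d, negLog d) := by
  have hp := measurable_pointPenalty
  simp only [refError]
  rw [lintegral_const_mul _ (by fun_prop), lintegral_add_left (by fun_prop)]
  simp only [lintegral_const, measure_univ, mul_one]
  gcongr

lemma transformedLaw_three_le {W : ℝ} (hW : Real.exp (Real.exp (Real.exp 1)) ≤ W)
    (μ ν : Measure ((Fin 3 → ℝ × ℝ) × (Fin 3 → Bool))) [IsProbabilityMeasure μ]
    [IsProbabilityMeasure ν] {δ : ℝ≥0∞}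
    (hμ : ∀ᵐ z ∂μ, ∀ i, (z.1 i).1 ∈ Icc (0 : ℝ) 1 ∧ (z.1 i).2 ∈ Icc (0 : ℝ) 1)
    (hν : ∀ᵐ z ∂ν, ∀ i, (z.1 i).1 ∈ Icc (0 : ℝ) 1 ∧ (z.1 i).2 ∈ Icc (0 : ℝ) 1)
    (heμ : ∫⁻ z, refError W z.1 ∂μ ≤ δ) (heν : ∫⁻ z, refError W z.1 ∂ν ≤ δ)
    {A : Set ((Fin 3 → ℝ × ℝ) × (Fin 3 → Bool))} (hA : MeasurableSet A)
    (heq : ∫⁻ z, refProb W A z.2 (pointPattern z.1) ∂μ =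
      ∫⁻ z, refProb W A z.2 (pointPattern z.1) ∂ν) :
    transformedLaw W 3 μ A ≤ transformedLaw W 3 ν A + 2 * δ := by
  have hmeas : Measurable fun z : (Fin 3 → ℝ × ℝ) × (Fin 3 → Bool) => refError W z.1 :=
    (measurable_refError W).comp measurable_fst
  have h1 : transformedLaw W 3 μ A ≤ ∫⁻ z, refProb W A z.2 (pointPattern z.1) ∂μ + δ := by
    rw [transformedLaw_apply hW μ hA]
    refine le_trans (lintegral_mono_ae ?_)
      ((lintegral_add_right _ hmeas).le.trans (add_le_add le_rfl heμ))
    filter_upwards [hμ] with z hz using (refProb_close hW hA z.2 hz).2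
  have h2 : ∫⁻ z, refProb W A z.2 (pointPattern z.1) ∂ν ≤ transformedLaw W 3 ν A + δ := by
    rw [transformedLaw_apply hW ν hA]
    refine le_trans (lintegral_mono_ae ?_)
      ((lintegral_add_right _ hmeas).le.trans (add_le_add le_rfl heν))
    filter_upwards [hν] with z hz using (refProb_close hW hA z.2 hz).1
  calc _ ≤ ∫⁻ z, refProb W A z.2 (pointPattern z.1) ∂ν + δ := heq ▸ h1
    _ ≤ (transformedLaw W 3 ν A + δ) + δ := add_le_add h2 le_rfl
    _ = _ := by ring

lemma transformedLaw_three_close {W : ℝ} (hW : Real.exp (Real.exp (Real.exp 1)) ≤ W)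
    {A : Set ((Fin 3 → ℝ × ℝ) × (Fin 3 → Bool))} (hA : MeasurableSet A) {δ : ℝ≥0∞}
    (hδ : 2 * (ENNReal.ofReal (4 / Real.log (Real.log W)) * (2 + 24 * ∫⁻ d, negLog d)) = δ) :
    transformedLaw W 3 (labeledSamples 3 squareDist squareDist) A ≤
        transformedLaw W 3 (mixedSamples 3) A + δ ∧
      transformedLaw W 3 (mixedSamples 3) A ≤
        transformedLaw W 3 (labeledSamples 3 squareDist squareDist) A + δ := by
  subst hδ
  obtain ⟨h1, h2⟩ := lintegral_labeledSamples_edge_le measurable_pointPenalty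
    lintegral_pointPenalty_pi_le
  obtain ⟨a1, a2⟩ := ae_mem_Icc_samples
  exact ⟨transformedLaw_three_le hW _ _ a1 a2 (lintegral_refError_le _ h1)
      (lintegral_refError_le _ h2) hA (lintegral_refProb_eq W A),
    transformedLaw_three_le hW _ _ a2 a1 (lintegral_refError_le _ h2)
      (lintegral_refError_le _ h1) hA (lintegral_refProb_eq W A).symm⟩

lemma tvDist_transformedLaw_le {W : ℝ} (hW : Real.exp (Real.exp (Real.exp 1)) ≤ W) {m : ℕ}
    (hm : m = 2 ∨ m = 3) :
    tvDist (transformedLaw W m (labeledSamples m squareDist squareDist))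
        (transformedLaw W m (mixedSamples m)) ≤
      8 * (2 + 24 * (∫⁻ d, negLog d).toReal) / Real.log (Real.log W) := by
  have hfin : ∫⁻ d, negLog d ≠ ⊤ := lintegral_negLog_lt_top.ne
  have hℓ : 0 < Real.log (Real.log W) := (Real.exp_pos 1).trans_le (iterated_log_bounds hW).1
  set δ : ℝ≥0∞ := 2 * (ENNReal.ofReal (4 / Real.log (Real.log W)) * (2 + 24 * ∫⁻ d, negLog d))
    with hδ
  have hδ' : δ ≠ ⊤ := by rw [hδ]; finiteness
  have hreal : δ.toReal = 8 * (2 + 24 * (∫⁻ d, negLog d).toReal) / Real.log (Real.log W) := by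
    rw [hδ, ENNReal.toReal_mul, ENNReal.toReal_mul, ENNReal.toReal_add (by simp) (by finiteness),
      ENNReal.toReal_mul, ENNReal.toReal_ofReal (by positivity)]
    norm_num
    ring
  have := isProbabilityMeasure_transformedLaw hW (labeledSamples m squareDist squareDist)
  have := isProbabilityMeasure_transformedLaw hW (mixedSamples m)
  rw [← hreal]
  refine tvDist_le hδ' fun A hA => ?_
  rcases hm with rfl | rfl
  · rw [← map_dropFirst_labeledSamples, ← map_dropFirst_mixedSamples,
      transformedLaw_map_dropFirst hW, transformedLaw_map_dropFirst hW,
      Measure.map_apply measurable_dropFirst hA, Measure.map_apply measurable_dropFirst hA]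
    exact transformedLaw_three_close hW (measurable_dropFirst hA) hδ.symm
  · exact transformedLaw_three_close hW hA hδ.symm

/-- **Lemma 3.10.** For all sufficiently large `W`, the law of `m ∈ {1,2,3}` labeled
samples from `((t+r)/2, (t+r)/2)`, transformed coordinatewise by independent random maps
from `M(W)`, is at total variation distance `0` (for `m = 1`) and at most
`C·(log log log W)/(log log W)` (for `m = 2, 3`, with `C` a universal constant) from the
law of `m` labeled samples from a uniformly random pair among `(t, r)` and `(r, t)`,
transformed likewise. -/
theorem transformed_square_edge_indistinguishable :
    ∃ C W₀ : ℝ, 0 < C ∧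
      ∀ W : ℝ, W₀ ≤ W →
        (tvDist
            (transformedLaw W 1 (labeledSamples 1 ((2 : ℝ≥0∞)⁻¹ • (tDist + rDist))
              ((2 : ℝ≥0∞)⁻¹ • (tDist + rDist))))
            (transformedLaw W 1 ((2 : ℝ≥0∞)⁻¹ •
              (labeledSamples 1 tDist rDist + labeledSamples 1 rDist tDist))) = 0) ∧
        ∀ m : ℕ, m = 2 ∨ m = 3 →
          tvDist
              (transformedLaw W m (labeledSamples m ((2 : ℝ≥0∞)⁻¹ • (tDist + rDist))
                ((2 : ℝ≥0∞)⁻¹ • (tDist + rDist))))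
              (transformedLaw W m ((2 : ℝ≥0∞)⁻¹ •
                (labeledSamples m tDist rDist + labeledSamples m rDist tDist))) ≤
            C * Real.log (Real.log (Real.log W)) / Real.log (Real.log W) := by
  refine ⟨8 * (2 + 24 * (∫⁻ d, negLog d).toReal), Real.exp (Real.exp (Real.exp 1)), by positivity,
    fun W hW => ⟨?_, fun m hm => ?_⟩⟩
  · have h := tvDist_self (transformedLaw W 1 (mixedSamples 1))
    nth_rewrite 1 [← labeledSamples_one_square_eq_mixedSamples] at h
    exact h
  · refine (tvDist_transformedLaw_le hW hm).trans ?_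
    have h1 := (iterated_log_bounds hW).1
    have hℓ : 0 < Real.log (Real.log W) := (Real.exp_pos 1).trans_le h1
    have h2 : 1 ≤ Real.log (Real.log (Real.log W)) := (Real.le_log_iff_exp_le hℓ).2 h1
    exact div_le_div_of_nonneg_right (le_mul_of_one_le_right (by positivity) h2) hℓ.le
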